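/- Assume all the measures dv_g and ν_a are simple and let s : [−1,1)×S^n → S^n be the continuous lift of the maximal directions with s(−1,·) = −e₁; set u_a = u_a^{s(a)}. Then u_{a*} = −u_a for every cap a. -/

import Mathlib

open MeasureTheory Metric Real Filter Set
open scoped RealInnerProductSpace ENNReal NNReal Topology Classical

noncomputable section

/-- Ambient Euclidean space `ℝ^{n+1}`. -/
abbrev Eu (n : ℕ) : Type := EuclideanSpace ℝ (Fin (n + 1))

/-- The unit sphere `S^n ⊆ ℝ^{n+1}` as a subset of the ambient space. -/
def sphSet (n : ℕ) : Set (Eu n) := Metric.sphere (0 : Eu n) 1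

/-- The canonical (round) volume measure of `S^n`, viewed as a measure on the
ambient space `ℝ^{n+1}` supported on the unit sphere. -/
def sphMeasure (n : ℕ) : Measure (Eu n) :=
  Measure.map Subtype.val ((volume : Measure (Eu n)).toSphere)

/-- `σ_n`, the volume of the round unit `n`-sphere. -/
def sigmaVol (n : ℕ) : ℝ := (sphMeasure n Set.univ).toReal

/-- The constant `K_n`. -/
def Kconst (n : ℕ) : ℝ :=
  ((n + 1 : ℝ) / n) *
    ((Real.Gamma n * Real.Gamma ((n + 1) / 2)) /
      (Real.Gamma (n + 1 / 2) * Real.Gamma (n / 2))) ^ ((2 : ℝ) / n)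

/-- The linear coordinate function `X_s(x) = s · x`. -/
def Xfun {n : ℕ} (s x : Eu n) : ℝ := ⟪s, x⟫

/-- The tangential gradient on the sphere of (the restriction of) an ambient function:
`∇_{S^n} f (x) = ∇f(x) - ⟨∇f(x), x⟩ x`. -/
def gradS {n : ℕ} (f : Eu n → ℝ) (x : Eu n) : Eu n :=
  gradient f x - ⟪gradient f x, x⟫ • x

/-- A conformal factor `w` represents the metric `g = w² g₀` on `S^n`; it is admissible if it
is smooth and positive on the sphere. -/
def IsConformalFactor (n : ℕ) (w : Eu n → ℝ) : Prop :=
  ContDiff ℝ (⊤ : ℕ∞) w ∧ ∀ x ∈ sphSet n, 0 < w x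

/-- The Riemannian measure `dv_g` of the conformal metric `g = w² g₀`, i.e. `w^n dv_{g₀}`. -/
def confMeasure (n : ℕ) (w : Eu n → ℝ) : Measure (Eu n) :=
  (sphMeasure n).withDensity fun x => ENNReal.ofReal (w x ^ n)

/-- The volume of `(S^n, g)`, `g = w² g₀`. -/
def confVol (n : ℕ) (w : Eu n → ℝ) : ℝ := (confMeasure n w Set.univ).toReal

/-- The Dirichlet energy `∫ |∇_g u|²_g dv_g` of the restriction to `S^n` of `V`,
for `g = w² g₀`: it equals `∫ w^{n-2} |∇_{g₀} V|²_{g₀} dv_{g₀}`. -/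
def dirichlet (n : ℕ) (w : Eu n → ℝ) (V : Eu n → ℝ) : ℝ :=
  ∫ x, w x ^ (n - 2) * ‖gradS V x‖ ^ 2 ∂(sphMeasure n)

/-- `∫ u² dv_g`. -/
def l2sq (n : ℕ) (w : Eu n → ℝ) (V : Eu n → ℝ) : ℝ :=
  ∫ x, (V x) ^ 2 ∂(confMeasure n w)

/-- Mean value zero w.r.t. `dv_g`. -/
def MeanZero (n : ℕ) (w : Eu n → ℝ) (V : Eu n → ℝ) : Prop :=
  ∫ x, V x ∂(confMeasure n w) = 0

/-- The second nonzero eigenvalue `λ₂(S^n, g)` of the Laplace–Beltrami operator of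
`g = w² g₀`, defined via the Courant–Fischer min-max characterization over two-dimensional
spaces of mean-zero test functions (restrictions of smooth ambient functions). -/
def lambda2 (n : ℕ) (w : Eu n → ℝ) : ℝ :=
  sInf { Λ : ℝ | ∃ V W : Eu n → ℝ, ContDiff ℝ (⊤ : ℕ∞) V ∧ ContDiff ℝ (⊤ : ℕ∞) W ∧
    MeanZero n w V ∧ MeanZero n w W ∧
    (∀ a b : ℝ, (∀ x ∈ sphSet n, a * V x + b * W x = 0) → a = 0 ∧ b = 0) ∧
    Λ = sSup { q : ℝ | ∃ a b : ℝ, ¬(a = 0 ∧ b = 0) ∧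
      q = dirichlet n w (fun x => a * V x + b * W x) /
          l2sq n w (fun x => a * V x + b * W x) } }

/-- The conformal transformation `d_ξ` of the closed unit ball. -/
def dMap {n : ℕ} (ξ : Eu n) (x : Eu n) : Eu n :=
  (1 + 2 * ⟪ξ, x⟫ + ‖x‖ ^ 2 * ‖ξ‖ ^ 2)⁻¹ •
    ((1 - ‖ξ‖ ^ 2) • x + (1 + 2 * ⟪ξ, x⟫ + ‖x‖ ^ 2) • ξ)

/-- The reflection `R_p(x) = x - 2(p·x)p`. -/
def Refl {n : ℕ} (p x : Eu n) : Eu n := x - (2 * ⟪p, x⟫) • p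

/-- The spherical cap `a_{r,p} = d_{rp}(a_{0,p})`. -/
def cap (n : ℕ) (r : ℝ) (p : Eu n) : Set (Eu n) :=
  dMap (r • p) '' {x ∈ sphSet n | 0 < ⟪p, x⟫}

/-- The conformal reflection `τ_{a_{r,p}} = d_{rp} ∘ R_p ∘ d_{-rp}`. -/
def tauMap {n : ℕ} (r : ℝ) (p : Eu n) : Eu n → Eu n :=
  dMap (r • p) ∘ Refl p ∘ dMap (-(r • p))

/-- The measure `μ_{a_{r,p}}`, equal to `dv_g + (τ_a)^* dv_g` on `a` and `0` on `a^*`. -/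
def capMeasure (n : ℕ) (w : Eu n → ℝ) (r : ℝ) (p : Eu n) : Measure (Eu n) :=
  (confMeasure n w + Measure.map (tauMap r p) (confMeasure n w)).restrict (cap n r p)

/-- `d_ξ` renormalizes the finite measure `μ`: `∫ X_s ∘ d_ξ dμ = 0` for all `s ∈ S^n`. -/
def Renormalizes {n : ℕ} (ξ : Eu n) (μ : Measure (Eu n)) : Prop :=
  ∀ s ∈ sphSet n, ∫ x, Xfun s (dMap ξ x) ∂μ = 0

/-- The quadratic form `Q(s) = ∫ X_s² dν` of a measure `ν`. -/
def Qform {n : ℕ} (ν : Measure (Eu n)) (s : Eu n) : ℝ := ∫ x, (⟪s, x⟫ : ℝ) ^ 2 ∂ν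

/-- The maximal eigenvalue of the quadratic form `Q`. -/
def maxEig (n : ℕ) (ν : Measure (Eu n)) : ℝ :=
  sSup { q : ℝ | ∃ s : Eu n, ‖s‖ = 1 ∧ q = Qform ν s }

/-- `ν` is simple with (unit) maximal direction `s₀`: the eigenspace of the maximal
eigenvalue of `Q` is the line spanned by `s₀`. -/
def IsMaxDir {n : ℕ} (ν : Measure (Eu n)) (s₀ : Eu n) : Prop :=
  ‖s₀‖ = 1 ∧ ∀ s : Eu n, Qform ν s = maxEig n ν * ‖s‖ ^ 2 ↔ ∃ c : ℝ, s = c • s₀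

/-- `ν` is multiple: the eigenspace of the maximal eigenvalue of `Q` has dimension ≥ 2. -/
def IsMultiple {n : ℕ} (ν : Measure (Eu n)) : Prop :=
  ∃ s t : Eu n, Qform ν s = maxEig n ν * ‖s‖ ^ 2 ∧ Qform ν t = maxEig n ν * ‖t‖ ^ 2 ∧
    LinearIndependent ℝ ![s, t]

/-- The test function `u_a^s` (for `a = a_{r,p}` with renormalization point `ξ`):
`X_s ∘ d_ξ` on `a` and `X_s ∘ d_ξ ∘ τ_a` on `a^*`. -/
def testFun (n : ℕ) (ξ : Eu n) (r : ℝ) (p : Eu n) (s : Eu n) (x : Eu n) : ℝ :=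
  if 0 < ⟪p, dMap (-(r • p)) x⟫ then Xfun s (dMap ξ x) else Xfun s (dMap ξ (tauMap r p x))

/-- The first coordinate vector `e₁ ∈ ℝ^{n+1}`. -/
def e1 (n : ℕ) : Eu n := EuclideanSpace.single 0 1

/-! ### A parity count for labellings of the Kuhn triangulation of a cube -/

/-- The `j`-th vertex of the Kuhn simplex based at `x`, where `σ i` is the step at which the
coordinate `i` is increased. -/
def kuhnVertex {d : ℕ} (x : Fin d → ℤ) (σ : Equiv.Perm (Fin d)) (j : ℕ) : Fin d → ℤ :=
  fun i => x i + if (σ i : ℕ) < j then 1 else 0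

lemma even_card_of_involutive_of_ne {α : Type*} (s : Finset α) (f : α → α)
    (hmem : ∀ a ∈ s, f a ∈ s) (hne : ∀ a ∈ s, f a ≠ a) (hinv : ∀ a ∈ s, f (f a) = a) :
    Even s.card := by
  have h : ∑ _x ∈ s, (1 : ZMod 2) = 0 :=
    Finset.sum_involution (fun a _ => f a) (fun _ _ => by decide) (fun a ha _ => hne a ha)
      hmem hinv
  rw [Finset.sum_const, nsmul_eq_mul, mul_one] at h
  exact (ZMod.natCast_eq_zero_iff_even).1 h

/-- `g` takes every value other than the last one away from the index `k`. -/
def IsDoor {d : ℕ} (g : Fin (d + 1) → Fin (d + 1)) (k : Fin (d + 1)) : Prop :=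
  ∀ c, c ≠ Fin.last d → ∃ j, j ≠ k ∧ g j = c

lemma IsDoor.injOn {d : ℕ} {g : Fin (d + 1) → Fin (d + 1)} {k : Fin (d + 1)}
    (hk : IsDoor g k) :
    (∀ j, j ≠ k → g j ≠ Fin.last d) ∧ ∀ i j, i ≠ k → j ≠ k → g i = g j → i = j := by
  have hsub : (Finset.univ.erase (Fin.last d)) ⊆ (Finset.univ.erase k).image g := by
    intro c hc
    obtain ⟨j, hj, rfl⟩ := hk c (Finset.ne_of_mem_erase hc)
    exact Finset.mem_image_of_mem _ (by simp [hj])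
  have hcard : ((Finset.univ.erase k).image g).card ≤ (Finset.univ.erase (Fin.last d)).card := by
    refine Finset.card_image_le.trans ?_
    simp
  have heq := Finset.eq_of_subset_of_card_le hsub hcard
  constructor
  · intro j hj h
    have : g j ∈ (Finset.univ.erase k).image g := Finset.mem_image_of_mem _ (by simp [hj])
    rw [← heq, h] at this
    simp at this
  · have hinj : Set.InjOn g (Finset.univ.erase k : Finset (Fin (d + 1))) := by
      apply Finset.injOn_of_card_image_eq
      rw [← heq]
      simp
    intro i j hi hj h
    exact hinj (by simp [hi]) (by simp [hj]) h

lemma card_isDoor {d : ℕ} (g : Fin (d + 1) → Fin (d + 1)) :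
    ((Finset.univ.filter (IsDoor g)).card : ZMod 2) =
      if Function.Bijective g then 1 else 0 := by
  split_ifs with hg
  · obtain ⟨k, hk⟩ := hg.2 (Fin.last d)
    have : Finset.univ.filter (IsDoor g) = {k} := by
      ext j
      simp only [Finset.mem_filter, Finset.mem_univ, true_and, Finset.mem_singleton]
      constructor
      · intro hj
        by_contra hne
        exact hj.injOn.1 k (Ne.symm hne) hk
      · rintro rfl c hc
        obtain ⟨i, rfl⟩ := hg.2 c
        exact ⟨i, fun h => hc (h ▸ hk), rfl⟩
    rw [this]
    simp
  · by_cases hne : ∃ k, IsDoor g k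
    · obtain ⟨k, hk⟩ := hne
      have hklast : g k ≠ Fin.last d := by
        intro hkl
        refine hg (Finite.injective_iff_bijective.1 fun i j hij => ?_)
        by_cases hi : i = k
        · by_cases hj : j = k
          · rw [hi, hj]
          · exact absurd (by rw [← hij, hi, hkl]) (hk.injOn.1 j hj)
        · by_cases hj : j = k
          · exact absurd (by rw [hij, hj, hkl]) (hk.injOn.1 i hi)
          · exact hk.injOn.2 i j hi hj hij
      obtain ⟨j, hj, hjk⟩ := hk (g k) hklast
      have : Finset.univ.filter (IsDoor g) = {k, j} := by
        ext l
        simp only [Finset.mem_filter, Finset.mem_univ, true_and, Finset.mem_insert,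
          Finset.mem_singleton]
        constructor
        · intro hl
          by_contra hne
          push Not at hne
          exact hj (hl.injOn.2 j k (Ne.symm hne.2) (Ne.symm hne.1) hjk)
        · rintro (rfl | rfl)
          · exact hk
          · intro c hc
            obtain ⟨i, hi, hic⟩ := hk c hc
            by_cases hij : i = l
            · exact ⟨k, Ne.symm hj, by rw [← hjk, ← hij, hic]⟩
            · exact ⟨i, hij, hic⟩
      rw [this, Finset.card_pair (Ne.symm hj)]
      decide
    · push Not at hne
      rw [Finset.filter_false_of_mem (fun k _ => hne k)]
      simp

/-- The base points of the unit cubes that subdivide `[-N, N]^d`. -/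
def cubeBase (d : ℕ) (N : ℤ) : Finset (Fin d → ℤ) :=
  Fintype.piFinset fun _ => Finset.Icc (-N) (N - 1)

lemma mem_cubeBase {d : ℕ} {N : ℤ} {x : Fin d → ℤ} :
    x ∈ cubeBase d N ↔ ∀ i, -N ≤ x i ∧ x i ≤ N - 1 := by
  simp [cubeBase, Fintype.mem_piFinset]

/-- The labels of the vertices of a Kuhn simplex. -/
def kuhnLabel {d : ℕ} (l : (Fin d → ℤ) → Fin (d + 1))
    (q : (Fin d → ℤ) × Equiv.Perm (Fin d)) (j : Fin (d + 1)) : Fin (d + 1) :=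
  l (kuhnVertex q.1 q.2 j)

/-- The Kuhn simplices in `[-N, N]^d` whose facet opposite to the vertex `k` carries all
labels but the last one. -/
def doors {d : ℕ} (N : ℤ) (l : (Fin d → ℤ) → Fin (d + 1)) (k : Fin (d + 1)) :
    Finset ((Fin d → ℤ) × Equiv.Perm (Fin d)) :=
  (cubeBase d N ×ˢ Finset.univ).filter fun q => IsDoor (kuhnLabel l q) k

lemma mem_doors {d : ℕ} {N : ℤ} {l : (Fin d → ℤ) → Fin (d + 1)} {k : Fin (d + 1)}
    {q : (Fin d → ℤ) × Equiv.Perm (Fin d)} :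
    q ∈ doors N l k ↔ (∀ i, -N ≤ q.1 i ∧ q.1 i ≤ N - 1) ∧ IsDoor (kuhnLabel l q) k := by
  simp [doors, mem_cubeBase]

lemma even_card_doors_middle {d : ℕ} (N : ℤ) (l : (Fin d → ℤ) → Fin (d + 1))
    (k : Fin (d + 1)) (h0 : k ≠ 0) (hd : k ≠ Fin.last d) : Even (doors N l k).card := by
  have hk0 : 0 < (k : ℕ) := Nat.pos_of_ne_zero fun h => h0 (Fin.ext h)
  have hkd : (k : ℕ) < d := by
    have := Fin.val_lt_last hd
    simpa using this
  set a : Fin d := ⟨k - 1, by omega⟩ with ha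
  set b : Fin d := ⟨k, hkd⟩ with hb
  have hab : a ≠ b := by
    intro h
    have := congrArg Fin.val h
    simp only [ha, hb] at this
    omega
  refine even_card_of_involutive_of_ne _ (fun q => (q.1, q.2.trans (Equiv.swap a b))) ?_ ?_ ?_
  · intro q hq
    rw [mem_doors] at hq ⊢
    refine ⟨hq.1, fun c hc => ?_⟩
    obtain ⟨j, hj, hjc⟩ := hq.2 c hc
    refine ⟨j, hj, ?_⟩
    rw [← hjc]
    unfold kuhnLabel kuhnVertex
    congr 1
    funext i
    congr 1
    have hjk : (j : ℕ) ≠ k := fun h => hj (Fin.ext h)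
    have key : ((Equiv.swap a b (q.2 i) : Fin d) : ℕ) < j ↔ (q.2 i : ℕ) < j := by
      rw [Equiv.swap_apply_def]
      split_ifs with h1 h2
      · rw [h1]; simp only [ha, hb]; omega
      · rw [h2]; simp only [ha, hb]; omega
      · rfl
    simp only [Equiv.trans_apply, key]
  · intro q _ h
    have h2 := congrArg (fun e => e.2 (q.2.symm a)) h
    simp only [Equiv.trans_apply, Equiv.apply_symm_apply, Equiv.swap_apply_left] at h2
    exact hab h2.symm
  · intro q _
    refine Prod.ext rfl (Equiv.ext fun i => ?_)
    simp

/-- The neighbour of a Kuhn simplex across the facet opposite to its first vertex. -/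
def kuhnShift {m : ℕ} (q : (Fin (m + 1) → ℤ) × Equiv.Perm (Fin (m + 1))) :
    (Fin (m + 1) → ℤ) × Equiv.Perm (Fin (m + 1)) :=
  (kuhnVertex q.1 q.2 1, q.2.trans (finRotate (m + 1)).symm)

/-- The neighbour of a Kuhn simplex across the facet opposite to its last vertex. -/
def kuhnUnshift {m : ℕ} (q : (Fin (m + 1) → ℤ) × Equiv.Perm (Fin (m + 1))) :
    (Fin (m + 1) → ℤ) × Equiv.Perm (Fin (m + 1)) :=
  (fun i => q.1 i - if q.2 i = Fin.last m then 1 else 0, q.2.trans (finRotate (m + 1)))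

/-- The image of a Kuhn simplex under `x ↦ -x`. -/
def kuhnNeg {d : ℕ} (q : (Fin d → ℤ) × Equiv.Perm (Fin d)) :
    (Fin d → ℤ) × Equiv.Perm (Fin d) :=
  (fun i => -q.1 i - 1, q.2.trans Fin.revPerm)

lemma finRotate_symm_val {m : ℕ} (i : Fin (m + 1)) :
    (((finRotate (m + 1)).symm i : Fin (m + 1)) : ℕ) = if i = 0 then m else (i : ℕ) - 1 := by
  obtain ⟨k, rfl⟩ := (finRotate (m + 1)).surjective i
  rw [Equiv.symm_apply_apply]
  have h := coe_finRotate k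
  split_ifs with h0
  · rw [h0] at h
    split_ifs at h with hk
    · rw [hk]; simp
    · simp at h
  · have : ((finRotate (m + 1) k : Fin (m + 1)) : ℕ) ≠ 0 := fun h' => h0 (Fin.ext h')
    split_ifs at h with hk
    · exact absurd h this
    · rw [h, Nat.add_sub_cancel]

lemma kuhnUnshift_kuhnShift {m : ℕ} (q : (Fin (m + 1) → ℤ) × Equiv.Perm (Fin (m + 1))) :
    kuhnUnshift (kuhnShift q) = q := by
  refine Prod.ext (funext fun i => ?_) (Equiv.ext fun i => by simp [kuhnShift, kuhnUnshift])
  have h := finRotate_symm_val (q.2 i)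
  have hl : (finRotate (m + 1)).symm (q.2 i) = Fin.last m ↔ ((q.2 i : Fin (m + 1)) : ℕ) < 1 := by
    rw [Fin.ext_iff, h, Fin.val_last]
    have := (q.2 i).2
    split_ifs with h0
    · rw [h0]; simp
    · have : ((q.2 i : Fin (m + 1)) : ℕ) ≠ 0 := fun h' => h0 (Fin.ext h')
      omega
  simp only [kuhnShift, kuhnUnshift, kuhnVertex, Equiv.trans_apply, hl]
  ring

lemma kuhnShift_kuhnUnshift {m : ℕ} (q : (Fin (m + 1) → ℤ) × Equiv.Perm (Fin (m + 1))) :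
    kuhnShift (kuhnUnshift q) = q := by
  refine Prod.ext (funext fun i => ?_) (Equiv.ext fun i => by simp [kuhnShift, kuhnUnshift])
  have h := coe_finRotate (q.2 i)
  have hl : ((finRotate (m + 1) (q.2 i) : Fin (m + 1)) : ℕ) < 1 ↔ q.2 i = Fin.last m := by
    rw [h]
    split_ifs with h0 <;> simp [h0]
  simp only [kuhnShift, kuhnUnshift, kuhnVertex, Equiv.trans_apply, hl]
  ring

lemma kuhnNeg_kuhnNeg {d : ℕ} (q : (Fin d → ℤ) × Equiv.Perm (Fin d)) :
    kuhnNeg (kuhnNeg q) = q := by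
  refine Prod.ext (funext fun i => ?_) (Equiv.ext fun i => by simp [kuhnNeg])
  simp only [kuhnNeg]
  ring

lemma kuhnVertex_kuhnShift {m : ℕ} (q : (Fin (m + 1) → ℤ) × Equiv.Perm (Fin (m + 1)))
    (j : ℕ) (hj : j ≤ m) :
    kuhnVertex (kuhnShift q).1 (kuhnShift q).2 j = kuhnVertex q.1 q.2 (j + 1) := by
  funext i
  have h := finRotate_symm_val (q.2 i)
  simp only [kuhnShift, kuhnVertex, Equiv.trans_apply, h]
  have hz : q.2 i = 0 ↔ ((q.2 i : Fin (m + 1)) : ℕ) = 0 := by rw [Fin.ext_iff, Fin.val_zero]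
  simp only [hz]
  split_ifs <;> omega

lemma kuhnVertex_kuhnNeg {d : ℕ} (q : (Fin d → ℤ) × Equiv.Perm (Fin d))
    (j : ℕ) (hj : j ≤ d) :
    kuhnVertex (kuhnNeg q).1 (kuhnNeg q).2 (d - j) = -kuhnVertex q.1 q.2 j := by
  funext i
  have h : ((Fin.rev (q.2 i) : Fin d) : ℕ) = d - (q.2 i + 1) := Fin.val_rev _
  have := (q.2 i).2
  simp only [kuhnNeg, kuhnVertex, Equiv.trans_apply, Fin.revPerm_apply, h, Pi.neg_apply]
  split_ifs <;> omega

lemma isDoor_zero_iff {d : ℕ} {g : Fin (d + 1) → Fin (d + 1)} :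
    IsDoor g 0 ↔ ∀ c, c ≠ Fin.last d → ∃ j : Fin d, g j.succ = c := by
  refine forall₂_congr fun c _ => ⟨?_, ?_⟩
  · rintro ⟨j, hj, h⟩
    exact ⟨j.pred hj, by simpa using h⟩
  · rintro ⟨j, h⟩
    exact ⟨j.succ, Fin.succ_ne_zero j, h⟩

lemma isDoor_last_iff {d : ℕ} {g : Fin (d + 1) → Fin (d + 1)} :
    IsDoor g (Fin.last d) ↔ ∀ c, c ≠ Fin.last d → ∃ j : Fin d, g j.castSucc = c := by
  refine forall₂_congr fun c _ => ⟨?_, ?_⟩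
  · rintro ⟨j, hj, h⟩
    exact ⟨j.castPred hj, by simpa using h⟩
  · rintro ⟨j, h⟩
    exact ⟨j.castSucc, Fin.castSucc_ne_last j, h⟩

lemma isDoor_kuhnShift {m : ℕ} (l : (Fin (m + 1) → ℤ) → Fin (m + 2))
    (q : (Fin (m + 1) → ℤ) × Equiv.Perm (Fin (m + 1))) :
    IsDoor (kuhnLabel l (kuhnShift q)) (Fin.last (m + 1)) ↔ IsDoor (kuhnLabel l q) 0 := by
  rw [isDoor_zero_iff, isDoor_last_iff]
  refine forall₂_congr fun c _ => exists_congr fun j => ?_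
  unfold kuhnLabel
  rw [Fin.val_castSucc, Fin.val_succ, kuhnVertex_kuhnShift _ _ (Nat.le_of_lt_succ j.2)]

lemma isDoor_kuhnNeg {d : ℕ} {N : ℤ} {l : (Fin d → ℤ) → Fin (d + 1)}
    (hl : ∀ y : Fin d → ℤ, (∀ i, |y i| ≤ N) → (∃ i, |y i| = N) → l (-y) = l y)
    {q : (Fin d → ℤ) × Equiv.Perm (Fin d)} (hq : ∀ i, -N ≤ q.1 i ∧ q.1 i ≤ N - 1)
    {k : Fin (d + 1)} (hface : ∃ i, ∀ j : Fin (d + 1), j ≠ k → |kuhnVertex q.1 q.2 j i| = N) :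
    IsDoor (kuhnLabel l q) k → IsDoor (kuhnLabel l (kuhnNeg q)) k.rev := by
  intro h c hc
  obtain ⟨j, hj, hjc⟩ := h c hc
  refine ⟨j.rev, fun h' => hj (Fin.rev_injective h'), ?_⟩
  rw [← hjc]
  unfold kuhnLabel
  have hr : ((Fin.rev j : Fin (d + 1)) : ℕ) = d - j := by rw [Fin.val_rev]; omega
  rw [hr, kuhnVertex_kuhnNeg _ _ (Nat.le_of_lt_succ j.2)]
  refine hl _ (fun i => ?_) ?_
  · have := hq i
    unfold kuhnVertex
    rw [abs_le]
    split_ifs <;> omega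
  · obtain ⟨i, hi⟩ := hface
    exact ⟨i, hi j hj⟩

lemma card_doors_zero {m : ℕ} (N : ℤ) (l : (Fin (m + 1) → ℤ) → Fin (m + 2))
    (hl : ∀ y : Fin (m + 1) → ℤ, (∀ i, |y i| ≤ N) → (∃ i, |y i| = N) → l (-y) = l y) :
    (doors N l 0).card = (doors N l (Fin.last (m + 1))).card := by
  have hneg : ∀ q : (Fin (m + 1) → ℤ) × Equiv.Perm (Fin (m + 1)),
      (∀ i, -N ≤ q.1 i ∧ q.1 i ≤ N - 1) →
        ∀ i, -N ≤ (kuhnNeg q).1 i ∧ (kuhnNeg q).1 i ≤ N - 1 := by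
    intro q hq i
    have := hq i
    simp only [kuhnNeg]
    omega
  refine Finset.card_nbij'
    (fun q => if ∃ i, kuhnVertex q.1 q.2 1 i = N then kuhnNeg q else kuhnShift q)
    (fun q => if ∃ i, (kuhnUnshift q).1 i < -N then kuhnNeg q else kuhnUnshift q) ?_ ?_ ?_ ?_
  · intro q hq
    rw [Finset.mem_coe, mem_doors] at hq
    rw [Finset.mem_coe]
    dsimp only
    split_ifs with h
    · rw [mem_doors, ← Fin.rev_zero]
      refine ⟨hneg q hq.1, isDoor_kuhnNeg hl hq.1 ?_ hq.2⟩
      obtain ⟨i, hi⟩ := h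
      refine ⟨i, fun j hj => ?_⟩
      have hj0 : (j : ℕ) ≠ 0 := fun h => hj (Fin.ext h)
      have := hq.1 i
      have hN : 0 ≤ N := by omega
      have : kuhnVertex q.1 q.2 j i = N := by
        simp only [kuhnVertex] at hi ⊢
        split_ifs at hi ⊢ <;> omega
      rw [this, abs_of_nonneg hN]
    · push Not at h
      rw [mem_doors, isDoor_kuhnShift]
      refine ⟨fun i => ?_, hq.2⟩
      have h1 := h i
      have h2 := hq.1 i
      simp only [kuhnShift]
      simp only [kuhnVertex] at h1 ⊢
      split_ifs at h1 ⊢ <;> omega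
  · intro q hq
    rw [Finset.mem_coe, mem_doors] at hq
    rw [Finset.mem_coe]
    dsimp only
    split_ifs with h
    · rw [mem_doors, ← Fin.rev_last]
      refine ⟨hneg q hq.1, isDoor_kuhnNeg hl hq.1 ?_ hq.2⟩
      obtain ⟨i, hi⟩ := h
      refine ⟨i, fun j hj => ?_⟩
      have hj0 : (j : ℕ) ≠ m + 1 := fun h => hj (Fin.ext h)
      have hj1 := j.2
      have h2 := hq.1 i
      have : kuhnVertex q.1 q.2 j i = -N := by
        simp only [kuhnUnshift] at hi
        simp only [kuhnVertex]
        split_ifs at hi with hi'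
        · rw [hi', Fin.val_last, if_neg (by omega)]
          omega
        · omega
      rw [this, abs_neg, abs_of_nonneg (by omega)]
    · push Not at h
      rw [mem_doors, ← isDoor_kuhnShift, kuhnShift_kuhnUnshift]
      refine ⟨fun i => ⟨h i, ?_⟩, hq.2⟩
      have h2 := hq.1 i
      simp only [kuhnUnshift]
      split_ifs <;> omega
  · intro q hq
    rw [Finset.mem_coe, mem_doors] at hq
    dsimp only
    by_cases h : ∃ i, kuhnVertex q.1 q.2 1 i = N
    · rw [if_pos h, if_pos, kuhnNeg_kuhnNeg]
      obtain ⟨i, hi⟩ := h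
      refine ⟨i, ?_⟩
      have h2 := hq.1 i
      simp only [kuhnVertex] at hi
      have hr : Fin.rev (q.2 i) = Fin.last m ↔ ((q.2 i : Fin (m + 1)) : ℕ) < 1 := by
        rw [Fin.rev_eq_iff, Fin.rev_last, Fin.ext_iff, Fin.val_zero]
        omega
      simp only [kuhnUnshift, kuhnNeg, Equiv.trans_apply, Fin.revPerm_apply, hr]
      split_ifs at hi ⊢ <;> omega
    · rw [if_neg h, if_neg, kuhnUnshift_kuhnShift]
      rw [kuhnUnshift_kuhnShift]
      push Not
      exact fun i => (hq.1 i).1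
  · intro q hq
    rw [Finset.mem_coe, mem_doors] at hq
    dsimp only
    by_cases h : ∃ i, (kuhnUnshift q).1 i < -N
    · rw [if_pos h, if_pos, kuhnNeg_kuhnNeg]
      obtain ⟨i, hi⟩ := h
      refine ⟨i, ?_⟩
      have h2 := hq.1 i
      simp only [kuhnUnshift] at hi
      have hr : ((Fin.rev (q.2 i) : Fin (m + 1)) : ℕ) < 1 ↔ q.2 i = Fin.last m := by
        rw [Fin.val_rev, Fin.ext_iff, Fin.val_last]
        omega
      simp only [kuhnVertex, kuhnNeg, Equiv.trans_apply, Fin.revPerm_apply, hr]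
      split_ifs at hi ⊢ <;> omega
    · rw [if_neg h, if_neg, kuhnShift_kuhnUnshift]
      have : kuhnVertex (kuhnUnshift q).1 (kuhnUnshift q).2 1 = q.1 :=
        congrArg Prod.fst (kuhnShift_kuhnUnshift q)
      rw [this]
      push Not
      intro i
      have := hq.1 i
      omega

/-- A labelling of `[-N, N]^d ∩ ℤ^d` which is even on the boundary has an even number of
fully labelled Kuhn simplices. -/
theorem even_card_fullyLabelled {m : ℕ} (N : ℤ) (l : (Fin (m + 1) → ℤ) → Fin (m + 2))
    (hl : ∀ y : Fin (m + 1) → ℤ, (∀ i, |y i| ≤ N) → (∃ i, |y i| = N) → l (-y) = l y) :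
    Even ((cubeBase (m + 1) N ×ˢ Finset.univ).filter
      fun q => Function.Bijective (kuhnLabel l q)).card := by
  rw [← ZMod.natCast_eq_zero_iff_even, Finset.card_filter, Nat.cast_sum]
  have h1 : ∀ q ∈ cubeBase (m + 1) N ×ˢ (Finset.univ : Finset (Equiv.Perm (Fin (m + 1)))),
      (((if Function.Bijective (kuhnLabel l q) then 1 else 0 : ℕ)) : ZMod 2) =
        ∑ k, if IsDoor (kuhnLabel l q) k then 1 else 0 := by
    intro q _
    rw [Nat.cast_ite, Nat.cast_one, Nat.cast_zero, ← card_isDoor, Finset.card_filter,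
      Nat.cast_sum]
    simp
  rw [Finset.sum_congr rfl h1, Finset.sum_comm]
  have h2 : ∀ k, (∑ q ∈ cubeBase (m + 1) N ×ˢ Finset.univ,
      if IsDoor (kuhnLabel l q) k then (1 : ZMod 2) else 0) = (doors N l k).card := by
    intro k
    rw [doors, Finset.card_filter, Nat.cast_sum]
    simp
  simp_rw [h2]
  rw [Fin.sum_univ_succ, Fin.sum_univ_castSucc, Finset.sum_eq_zero, zero_add,
    card_doors_zero N l hl, Fin.succ_last, CharTwo.add_self_eq_zero]
  intro k _
  rw [ZMod.natCast_eq_zero_iff_even]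
  refine even_card_doors_middle N l _ (Fin.succ_ne_zero _) ?_
  rw [Fin.succ_castSucc]
  exact Fin.castSucc_ne_last _

/-! ### Even tangent fields have zeros -/

/-- `c` is the index of the first negative coordinate of `y`, or the last element of
`Fin (d + 1)` if `y` has no negative coordinate. -/
def IsFirstNeg {d : ℕ} {R : Type*} [LinearOrder R] [Zero R] (y : Fin d → R)
    (c : Fin (d + 1)) : Prop :=
  (∀ j : Fin d, j.castSucc < c → 0 ≤ y j) ∧ ∀ i : Fin d, c = i.castSucc → y i < 0

lemma exists_isFirstNeg {d : ℕ} {R : Type*} [LinearOrder R] [Zero R] (y : Fin d → R) :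
    ∃ c, IsFirstNeg y c := by
  by_cases h : ∃ i, y i < 0
  · obtain ⟨i, hi⟩ := h
    obtain ⟨k, hk, hmin⟩ := WellFounded.has_min (wellFounded_lt (α := Fin d)) {i | y i < 0} ⟨i, hi⟩
    refine ⟨k.castSucc, fun j hj => ?_, fun i hi => ?_⟩
    · by_contra hneg
      exact hmin j (lt_of_not_ge hneg) (by simpa using hj)
    · rw [← Fin.castSucc_injective _ hi]
      exact hk
  · push Not at h
    exact ⟨Fin.last d, fun j _ => h j, fun i hi => absurd hi.symm (Fin.castSucc_ne_last i)⟩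

lemma IsFirstNeg.mono {d : ℕ} {R : Type*} [LinearOrder R] [Zero R] {y z : Fin d → R}
    {c e : Fin (d + 1)} (hc : IsFirstNeg y c) (he : IsFirstNeg z e) (hyz : y ≤ z) : c ≤ e := by
  by_contra h
  push Not at h
  have hne : e ≠ Fin.last d := (h.trans_le (Fin.le_last c)).ne
  obtain ⟨i, rfl⟩ := Fin.exists_castSucc_eq.2 hne
  exact absurd ((hc.1 i h).trans (hyz i)) (not_le.2 (he.2 i rfl))

lemma IsFirstNeg.unique {d : ℕ} {R : Type*} [LinearOrder R] [Zero R] {y : Fin d → R}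
    {c e : Fin (d + 1)} (hc : IsFirstNeg y c) (he : IsFirstNeg y e) : c = e :=
  le_antisymm (hc.mono he le_rfl) (he.mono hc le_rfl)

lemma kuhnVertex_mono {d : ℕ} (x : Fin d → ℤ) (σ : Equiv.Perm (Fin d)) {j k : ℕ} (h : j ≤ k) :
    kuhnVertex x σ j ≤ kuhnVertex x σ k := by
  intro i
  simp only [kuhnVertex]
  split_ifs <;> omega

/-- The label pattern of the identity map singles out one Kuhn simplex. -/
lemma fullyLabelled_firstNeg_iff {d : ℕ} (q : (Fin d → ℤ) × Equiv.Perm (Fin d))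
    (g : Fin (d + 1) → Fin (d + 1)) (hg : ∀ j : Fin (d + 1), IsFirstNeg (kuhnVertex q.1 q.2 j) (g j)) :
    Function.Bijective g ↔ q = (fun _ => -1, Equiv.refl _) := by
  constructor
  · intro hb
    have hmono : StrictMono g := by
      refine Monotone.strictMono_of_injective (fun j k hjk => ?_) hb.1
      exact (hg j).mono (hg k) (kuhnVertex_mono _ _ hjk)
    have hid : ∀ j, g j = j := by
      intro j
      have := Subsingleton.elim (hmono.orderIsoOfSurjective g hb.2) (OrderIso.refl _)
      exact congrArg (fun e => e j) this
    have key : ∀ i : Fin d, q.1 i = -1 ∧ q.2 i = i := by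
      intro i
      have h1 := (hg i.castSucc).2 i (hid _)
      have h2 := (hg i.succ).1 i (by rw [hid]; exact Fin.castSucc_lt_succ)
      simp only [kuhnVertex, Fin.val_castSucc, Fin.val_succ] at h1 h2
      rw [Fin.ext_iff]
      split_ifs at h1 h2 <;> omega
    exact Prod.ext (funext fun i => (key i).1) (Equiv.ext fun i => (key i).2)
  · rintro rfl
    have : g = id := by
      funext j
      refine (hg j).unique ⟨fun i hi => ?_, fun i hi => ?_⟩
      · have hi' : (i : ℕ) < j := hi
        simp [kuhnVertex, hi']
      · have hi' : (j : ℕ) = i := congrArg Fin.val hi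
        simp [kuhnVertex, hi']
    rw [this]
    exact Function.bijective_id

/-- A continuous map of the cube `[-1, 1]^d` that is even on the boundary cannot coincide with
the identity near the origin and be nonzero elsewhere. -/
theorem exists_zero_of_even_boundary {m : ℕ} (f : (Fin (m + 1) → ℝ) → Fin (m + 1) → ℝ)
    (hf : ContinuousOn f (Metric.closedBall 0 1))
    (hid : ∀ x, ‖x‖ ≤ 1 / 2 → f x = x) (heven : ∀ x, ‖x‖ = 1 → f (-x) = f x) :
    ∃ x, x ≠ 0 ∧ ‖x‖ ≤ 1 ∧ f x = 0 := by
  by_contra hcon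
  push Not at hcon
  have hK : IsCompact (Metric.closedBall (0 : Fin (m + 1) → ℝ) 1 \ Metric.ball 0 (1 / 4)) :=
    (isCompact_closedBall _ _).diff Metric.isOpen_ball
  obtain ⟨δ, hδ, hlow⟩ : ∃ δ > 0, ∀ x, 1 / 4 ≤ ‖x‖ → ‖x‖ ≤ 1 → δ ≤ ‖f x‖ := by
    by_cases hne : (Metric.closedBall (0 : Fin (m + 1) → ℝ) 1 \ Metric.ball 0 (1 / 4)).Nonempty
    · obtain ⟨x₀, hx₀, hmin⟩ :=
        hK.exists_isMinOn hne (hf.norm.mono Set.sdiff_subset)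
      have h0 : 1 / 4 ≤ ‖x₀‖ ∧ ‖x₀‖ ≤ 1 := by simpa [and_comm] using hx₀
      refine ⟨‖f x₀‖, norm_pos_iff.2 (hcon x₀ (norm_pos_iff.1 (by linarith [h0.1])) h0.2),
        fun x h1 h2 => hmin ?_⟩
      simpa using ⟨h2, by linarith⟩
    · refine ⟨1, one_pos, fun x h1 h2 => absurd ⟨x, ?_⟩ hne⟩
      simpa using ⟨h2, by linarith⟩
  obtain ⟨η, hη, huc⟩ := Metric.uniformContinuousOn_iff.1
    ((isCompact_closedBall (0 : Fin (m + 1) → ℝ) 1).uniformContinuousOn_of_continuous hf) δ hδ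
  obtain ⟨N, hN⟩ := exists_nat_gt (max 4 (1 / η))
  have hN4 : (4 : ℝ) < N := (le_max_left _ _).trans_lt hN
  have hNη : 1 / (N : ℝ) < η := by
    rw [div_lt_comm₀ (by linarith) hη]
    exact (le_max_right _ _).trans_lt hN
  have hN0 : (0 : ℝ) < N := by linarith
  set sc : (Fin (m + 1) → ℤ) → Fin (m + 1) → ℝ := fun y i => (y i : ℝ) / N with hsc
  choose lab hlab using fun y : Fin (m + 1) → ℝ => exists_isFirstNeg y
  set l : (Fin (m + 1) → ℤ) → Fin (m + 2) := fun y => lab (f (sc y)) with hl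
  have hscnorm : ∀ y : Fin (m + 1) → ℤ, (∀ i, |y i| ≤ N) → ‖sc y‖ ≤ 1 := by
    intro y hy
    refine (pi_norm_le_iff_of_nonneg zero_le_one).2 fun i => ?_
    rw [hsc, Real.norm_eq_abs, abs_div, Nat.abs_cast, div_le_one hN0]
    exact_mod_cast hy i
  have heven' : ∀ y : Fin (m + 1) → ℤ, (∀ i, |y i| ≤ N) → (∃ i, |y i| = N) → l (-y) = l y := by
    rintro y hy ⟨i, hi⟩
    have hneg : sc (-y) = -sc y := by
      funext i
      simp [hsc, neg_div]
    have h1 : ‖sc y‖ = 1 := by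
      refine le_antisymm (hscnorm y hy) ?_
      have h2 := norm_le_pi_norm (sc y) i
      have h3 : ‖sc y i‖ = 1 := by
        rw [hsc, Real.norm_eq_abs, abs_div, Nat.abs_cast, div_eq_one_iff_eq hN0.ne']
        exact_mod_cast hi
      linarith
    rw [hl]
    simp only
    rw [hneg, heven _ h1]
  have hpar := even_card_fullyLabelled (N : ℤ) l heven'
  have hset : (cubeBase (m + 1) N ×ˢ Finset.univ).filter
      (fun q => Function.Bijective (kuhnLabel l q)) =
      {((fun _ => -1, Equiv.refl _) : (Fin (m + 1) → ℤ) × Equiv.Perm (Fin (m + 1)))} := by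
    have hfirst : ∀ (q : (Fin (m + 1) → ℤ) × Equiv.Perm (Fin (m + 1))),
        (∀ j : Fin (m + 2), ‖sc (kuhnVertex q.1 q.2 j)‖ ≤ 1 / 2) →
        ∀ j : Fin (m + 2), IsFirstNeg (kuhnVertex q.1 q.2 j) (kuhnLabel l q j) := by
      intro q hq j
      have h := hlab (f (sc (kuhnVertex q.1 q.2 j)))
      rw [hid _ (hq j)] at h
      have h' : kuhnLabel l q j = lab (sc (kuhnVertex q.1 q.2 j)) := by
        simp only [kuhnLabel, hl, hid _ (hq j)]
      rw [h']
      refine ⟨fun i hi => ?_, fun i hi => ?_⟩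
      · have := h.1 i hi
        rw [hsc] at this
        have h2 : (0 : ℝ) ≤ (kuhnVertex q.1 q.2 j i : ℤ) := by
          by_contra hn
          exact absurd (div_neg_of_neg_of_pos (not_le.1 hn) hN0) (not_lt.2 this)
        exact_mod_cast h2
      · have := h.2 i hi
        rw [hsc] at this
        have h2 : ((kuhnVertex q.1 q.2 j i : ℤ) : ℝ) < 0 := by
          by_contra hn
          exact absurd (div_nonneg (not_lt.1 hn) hN0.le) (not_le.2 this)
        exact_mod_cast h2
    ext q
    rw [Finset.mem_filter, Finset.mem_product, mem_cubeBase, Finset.mem_singleton]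
    constructor
    · rintro ⟨⟨hq, -⟩, hb⟩
      have hv1 : ∀ j, ‖sc (kuhnVertex q.1 q.2 j)‖ ≤ 1 := by
        refine fun j => hscnorm _ fun i => ?_
        have := hq i
        rw [abs_le]
        simp only [kuhnVertex]
        split_ifs <;> omega
      have hdist : ∀ j k, dist (sc (kuhnVertex q.1 q.2 j)) (sc (kuhnVertex q.1 q.2 k)) ≤ 1 / N := by
        intro j k
        refine (dist_pi_le_iff (by positivity)).2 fun i => ?_
        rw [Real.dist_eq, hsc]
        simp only
        rw [← sub_div, abs_div, Nat.abs_cast]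
        gcongr
        rw [← Int.cast_sub, ← Int.cast_abs]
        have : |kuhnVertex q.1 q.2 j i - kuhnVertex q.1 q.2 k i| ≤ 1 := by
          simp only [kuhnVertex]
          rw [abs_le]
          split_ifs <;> omega
        exact_mod_cast this
      have hsmall : ‖f (sc (kuhnVertex q.1 q.2 0))‖ < δ := by
        have hd : ∀ j i, |f (sc (kuhnVertex q.1 q.2 0)) i - f (sc (kuhnVertex q.1 q.2 j)) i| < δ := by
          intro j i
          have h1 := huc _ (by simpa using hv1 0) _ (by simpa using hv1 j)
            ((hdist 0 j).trans_lt hNη)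
          exact (dist_le_pi_dist _ _ i).trans_lt h1
        refine (pi_norm_lt_iff hδ).2 fun i => ?_
        obtain ⟨j, hj⟩ := hb.2 i.castSucc
        obtain ⟨k, hk⟩ := hb.2 (Fin.last (m + 1))
        have h1 := (hlab (f (sc (kuhnVertex q.1 q.2 j)))).2 i hj
        have h2 := (hlab (f (sc (kuhnVertex q.1 q.2 k)))).1 i
          (lt_of_lt_of_eq (Fin.castSucc_lt_last i) hk.symm)
        have h3 := abs_lt.1 (hd j i)
        have h4 := abs_lt.1 (hd k i)
        rw [Real.norm_eq_abs, abs_lt]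
        constructor <;> linarith [h3.1, h3.2, h4.1, h4.2]
      have hquarter : ‖sc (kuhnVertex q.1 q.2 0)‖ < 1 / 4 := by
        by_contra h
        exact absurd (hlow _ (not_lt.1 h) (hv1 0)) (not_le.2 hsmall)
      refine (fullyLabelled_firstNeg_iff q _ (hfirst q fun j => ?_)).1 hb
      have h1 := hdist j 0
      have h2 : 1 / (N : ℝ) ≤ 1 / 4 := one_div_le_one_div_of_le (by norm_num) hN4.le
      have h3 := norm_le_norm_add_norm_sub' (sc (kuhnVertex q.1 q.2 j)) (sc (kuhnVertex q.1 q.2 0))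
      rw [← dist_eq_norm] at h3
      linarith
    · rintro rfl
      have hN5 : (4 : ℤ) < N := by exact_mod_cast hN4
      refine ⟨⟨fun i => ?_, Finset.mem_univ _⟩, (fullyLabelled_firstNeg_iff _ _
        (hfirst _ fun j => ?_)).2 rfl⟩
      · simp only
        omega
      · refine (pi_norm_le_iff_of_nonneg (by norm_num)).2 fun i => ?_
        rw [hsc, Real.norm_eq_abs, abs_div, Nat.abs_cast, div_le_iff₀ hN0]
        have : |kuhnVertex (fun _ : Fin (m + 1) => (-1 : ℤ)) (Equiv.refl _) j i| ≤ 1 := by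
          simp only [kuhnVertex]
          split_ifs <;> simp
        have h2 : |((kuhnVertex (fun _ : Fin (m + 1) => (-1 : ℤ)) (Equiv.refl _) j i : ℤ) : ℝ)| ≤ 1 := by
          exact_mod_cast this
        linarith
  rw [hset, Finset.card_singleton] at hpar
  exact absurd hpar (by decide)

/-- A continuous even vector field on `ℝ^d` that is orthogonal to the position vector vanishes
away from the origin. -/
theorem exists_zero_of_even_tangent {m : ℕ} (V : (Fin (m + 1) → ℝ) → Fin (m + 1) → ℝ)
    (hV : Continuous V) (heven : ∀ x, V (-x) = V x) (htan : ∀ x, ∑ i, x i * V x i = 0) :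
    ∃ x, x ≠ 0 ∧ V x = 0 := by
  set ψ : (Fin (m + 1) → ℝ) → ℝ := fun x => max 0 (2 * ‖x‖ - 1) with hψ
  obtain ⟨x, hx, hx1, hfx⟩ := exists_zero_of_even_boundary
    (fun x => (1 - ψ x) • x + ψ x • V x) (by fun_prop)
    (fun x hx => by
      have : ψ x = 0 := max_eq_left (by linarith)
      simp [this])
    (fun x hx => by
      have h : ψ x = 1 := by simp only [hψ, hx]; norm_num
      have h' : ψ (-x) = 1 := by simp only [hψ, norm_neg, hx]; norm_num
      simp [h, h', heven])
  refine ⟨x, hx, ?_⟩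
  have hsum : (1 - ψ x) * ∑ i, x i * x i = 0 := by
    have h1 : ∑ i, x i * ((1 - ψ x) • x + ψ x • V x) i = 0 := by
      refine Finset.sum_eq_zero fun i _ => ?_
      rw [hfx, Pi.zero_apply, mul_zero]
    have h2 : ∑ i, x i * ((1 - ψ x) • x + ψ x • V x) i =
        (1 - ψ x) * ∑ i, x i * x i + ψ x * ∑ i, x i * V x i := by
      rw [Finset.mul_sum, Finset.mul_sum, ← Finset.sum_add_distrib]
      refine Finset.sum_congr rfl fun i _ => ?_
      simp only [Pi.add_apply, Pi.smul_apply, smul_eq_mul]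
      ring
    rw [h2, htan, mul_zero, add_zero] at h1
    exact h1
  have hxx : ∑ i, x i * x i ≠ 0 := by
    intro h
    rw [Finset.sum_eq_zero_iff_of_nonneg fun i _ => mul_self_nonneg _] at h
    exact hx (funext fun i => mul_self_eq_zero.1 (h i (Finset.mem_univ i)))
  have hψ1 : ψ x = 1 := by linarith [(mul_eq_zero.1 hsum).resolve_right hxx]
  simpa [hψ1] using hfx

/-! ### Homotopies of unit vector fields to a constant -/

/-- The degree one extension to `ℝ × ℝ^{n+1}` of a homotopy parametrized by
`[-1, 0] × S^n` which is constant, equal to `c`, at time `-1`. -/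
def coneExt {n : ℕ} (σ : ℝ → Eu n → Eu n) (c : Eu n) (q : ℝ × Eu n) : Eu n :=
  (|q.1| + ‖q.2‖) •
    if q.2 = 0 then c else σ (-(|q.1| / (|q.1| + ‖q.2‖))) (‖q.2‖⁻¹ • q.2)

lemma coneExt_param_mem {n : ℕ} (t : ℝ) {x : Eu n} (hx : x ≠ 0) :
    (-(|t| / (|t| + ‖x‖)), ‖x‖⁻¹ • x) ∈ Set.Icc (-1 : ℝ) 0 ×ˢ sphSet n := by
  have hx' : 0 < ‖x‖ := norm_pos_iff.2 hx
  have ht := abs_nonneg t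
  refine ⟨⟨neg_le_neg ?_, neg_nonpos.2 (by positivity)⟩, ?_⟩
  · rw [div_le_one (by positivity)]
    linarith
  · simp only [sphSet, mem_sphere_zero_iff_norm, norm_smul, norm_inv, norm_norm]
    exact inv_mul_cancel₀ hx'.ne'

lemma norm_coneExt {n : ℕ} {σ : ℝ → Eu n → Eu n} {c : Eu n} (hc : ‖c‖ = 1)
    (hσ1 : ∀ r ∈ Set.Icc (-1 : ℝ) 0, ∀ p ∈ sphSet n, ‖σ r p‖ = 1) (q : ℝ × Eu n) :
    ‖coneExt σ c q‖ = |q.1| + ‖q.2‖ := by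
  rw [coneExt, norm_smul, Real.norm_eq_abs, abs_of_nonneg (by positivity)]
  split_ifs with h
  · rw [hc, mul_one]
  · have := coneExt_param_mem q.1 h
    rw [hσ1 _ this.1 _ this.2, mul_one]

lemma continuous_coneExt {n : ℕ} {σ : ℝ → Eu n → Eu n} {c : Eu n} (hc : ‖c‖ = 1)
    (hσ : ContinuousOn (fun q : ℝ × Eu n => σ q.1 q.2) (Set.Icc (-1 : ℝ) 0 ×ˢ sphSet n))
    (hσ1 : ∀ r ∈ Set.Icc (-1 : ℝ) 0, ∀ p ∈ sphSet n, ‖σ r p‖ = 1)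
    (hinit : ∀ p ∈ sphSet n, σ (-1) p = c) :
    Continuous (coneExt σ c) := by
  rw [continuous_iff_continuousAt]
  rintro ⟨t, x⟩
  by_cases h0 : |t| + ‖x‖ = 0
  · have hval : coneExt σ c (t, x) = 0 := by simp [coneExt, h0]
    rw [ContinuousAt, hval]
    refine squeeze_zero_norm (fun q => (norm_coneExt hc hσ1 q).le) ?_
    have : Continuous fun q : ℝ × Eu n => |q.1| + ‖q.2‖ := by fun_prop
    simpa [h0] using this.tendsto (t, x)
  have hr : ContinuousAt (fun q : ℝ × Eu n => -(|q.1| / (|q.1| + ‖q.2‖))) (t, x) := by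
    have h1 : Continuous fun q : ℝ × Eu n => |q.1| := by fun_prop
    have h2 : Continuous fun q : ℝ × Eu n => |q.1| + ‖q.2‖ := by fun_prop
    exact (h1.continuousAt.div h2.continuousAt h0).neg
  have hsum : Continuous fun q : ℝ × Eu n => |q.1| + ‖q.2‖ := by fun_prop
  refine ContinuousAt.smul hsum.continuousAt ?_
  by_cases hx : x = 0
  · subst hx
    rw [ContinuousAt, if_pos rfl, Metric.tendsto_nhds]
    intro ε hε
    have hK : IsCompact (Set.Icc (-1 : ℝ) 0 ×ˢ sphSet n) :=
      isCompact_Icc.prod (isCompact_sphere _ _)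
    obtain ⟨δ, hδ, huc⟩ := Metric.uniformContinuousOn_iff.1
      (hK.uniformContinuousOn_of_continuous hσ) ε hε
    have hlim : -(|t| / (|t| + ‖(0 : Eu n)‖)) = -1 := by
      rw [norm_zero, add_zero] at h0 ⊢
      rw [div_self h0]
    filter_upwards [Metric.tendsto_nhds.1 hr δ hδ] with q hq
    simp only [hlim] at hq
    split_ifs with hq0
    · simpa using hε
    · have hmem := coneExt_param_mem q.1 hq0
      rw [← hinit _ hmem.2]
      refine huc _ hmem (-1, ‖q.2‖⁻¹ • q.2) ⟨by norm_num, hmem.2⟩ ?_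
      rw [Prod.dist_eq, dist_self, max_eq_left dist_nonneg]
      exact hq
  · have hev : ∀ᶠ q : ℝ × Eu n in 𝓝 (t, x), q.2 ≠ 0 :=
      continuousAt_snd.eventually_ne hx
    have hmap : Tendsto (fun q : ℝ × Eu n => (-(|q.1| / (|q.1| + ‖q.2‖)), ‖q.2‖⁻¹ • q.2))
        (𝓝 (t, x)) (𝓝[Set.Icc (-1 : ℝ) 0 ×ˢ sphSet n]
          (-(|t| / (|t| + ‖x‖)), ‖x‖⁻¹ • x)) := by
      rw [tendsto_nhdsWithin_iff]
      refine ⟨hr.prodMk ?_, hev.mono fun q hq => coneExt_param_mem q.1 hq⟩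
      exact (continuousAt_snd.norm.inv₀ (norm_ne_zero_iff.2 hx)).smul continuousAt_snd
    have hcomp := (hσ _ (coneExt_param_mem t hx)).tendsto.comp hmap
    rw [ContinuousAt, if_neg hx]
    refine hcomp.congr' (hev.mono fun q hq => ?_)
    simp [hq]

/-- A continuous family of unit vectors on `[-1, 0] × S^n` that is constant at time `-1` cannot
be equivariant, at time `0`, for the antipodal map and the reflections. -/
theorem not_reflection_equivariant {n : ℕ} (σ : ℝ → Eu n → Eu n) (c : Eu n) (hc : ‖c‖ = 1)
    (hσ : ContinuousOn (fun q : ℝ × Eu n => σ q.1 q.2) (Set.Icc (-1 : ℝ) 0 ×ˢ sphSet n))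
    (hσ1 : ∀ r ∈ Set.Icc (-1 : ℝ) 0, ∀ p ∈ sphSet n, ‖σ r p‖ = 1)
    (hinit : ∀ p ∈ sphSet n, σ (-1) p = c) :
    ¬ ∀ p ∈ sphSet n, σ 0 (-p) = Refl p (σ 0 p) := by
  intro hrefl
  have hA := continuous_coneExt hc hσ hσ1 hinit
  have hAnorm := norm_coneExt hc hσ1
  have hA0 : ∀ x : Eu n,
      ‖x‖ ^ 2 • coneExt σ c (0, -x) =
        ‖x‖ ^ 2 • coneExt σ c (0, x) - (2 * ⟪x, coneExt σ c (0, x)⟫) • x := by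
    intro x
    by_cases hx : x = 0
    · simp [hx]
    have hx' : ‖x‖ ≠ 0 := norm_ne_zero_iff.2 hx
    have hmem := (coneExt_param_mem 0 hx).2
    simp only [coneExt, neg_eq_zero, hx, if_false, norm_neg, abs_zero, zero_add, zero_div,
      neg_zero, smul_neg]
    rw [hrefl _ hmem, Refl, inner_smul_left, inner_smul_right, smul_sub, smul_sub, smul_smul,
      smul_smul, smul_smul, smul_smul]
    congr 2
    simp only [conj_trivial]
    field_simp
  set X₂ : (Fin (n + 2) → ℝ) → Eu n := fun X => WithLp.toLp 2 (Fin.tail X) with hX₂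
  have hX₂c : Continuous X₂ := by
    refine (PiLp.continuous_toLp 2 _).comp (continuous_pi fun i => ?_)
    exact continuous_apply _
  set A : (Fin (n + 2) → ℝ) → Eu n := fun X => coneExt σ c (X 0, X₂ X) with hAdef
  have hAc : Continuous A := hA.comp ((continuous_apply 0).prodMk hX₂c)
  set U : (Fin (n + 2) → ℝ) → Fin (n + 2) → ℝ := fun X =>
    Fin.cons (-(⟪A X, X₂ X⟫ * (|X 0| + 2 * ‖X₂ X‖)))
      ((|X 0| + ‖X₂ X‖) ^ 2 • A X - ⟪A X, X₂ X⟫ • X₂ X).ofLp with hU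
  have hUc : Continuous U := by
    refine continuous_pi fun i => ?_
    refine Fin.cases ?_ (fun i => ?_) i
    · simp only [hU, Fin.cons_zero]
      fun_prop
    · simp only [hU, Fin.cons_succ]
      have : Continuous fun X => (|X 0| + ‖X₂ X‖) ^ 2 • A X - ⟪A X, X₂ X⟫ • X₂ X := by fun_prop
      exact (continuous_apply i).comp ((PiLp.continuous_ofLp 2 _).comp this)
  have hX₂neg : ∀ X, X₂ (-X) = -X₂ X := fun X => rfl
  have hUeven : ∀ X, X 0 = 0 → U (-X) = U X := by
    intro X h0
    have h1 := hA0 (X₂ X)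
    have hAX : A X = coneExt σ c (0, X₂ X) := by simp only [hAdef, h0]
    have hAX' : A (-X) = coneExt σ c (0, -X₂ X) := by
      simp only [hAdef, Pi.neg_apply, h0, neg_zero, hX₂neg]
    rw [← hAX, ← hAX'] at h1
    have h2 : ⟪A (-X), X₂ X⟫ * ‖X₂ X‖ = -(⟪A X, X₂ X⟫ * ‖X₂ X‖) := by
      by_cases hx : ‖X₂ X‖ = 0
      · simp [hx]
      have h3 := congrArg (fun v => ⟪v, X₂ X⟫) h1
      simp only [inner_smul_left, inner_sub_left, real_inner_self_eq_norm_sq,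
        conj_trivial, real_inner_comm (A X) (X₂ X)] at h3
      have h4 : ⟪A (-X), X₂ X⟫ = -⟪A X, X₂ X⟫ := by
        have : ‖X₂ X‖ ^ 2 * (⟪A (-X), X₂ X⟫ + ⟪A X, X₂ X⟫) = 0 := by linarith
        have := (mul_eq_zero.1 this).resolve_left (pow_ne_zero 2 hx)
        linarith
      rw [h4]
      ring
    have h5 : ⟪A (-X), X₂ X⟫ • X₂ X = -(⟪A X, X₂ X⟫ • X₂ X) := by
      by_cases hx : ‖X₂ X‖ = 0
      · simp [norm_eq_zero.1 hx]
      · rw [← neg_smul]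
        congr 1
        exact mul_right_cancel₀ hx (by rw [h2]; ring)
    simp only [hU, hX₂neg, Pi.neg_apply, h0, neg_zero, abs_zero, zero_add, norm_neg,
      inner_neg_right, smul_neg, neg_smul, neg_neg]
    have h6 : -(-⟪A (-X), X₂ X⟫ * (2 * ‖X₂ X‖)) = -(⟪A X, X₂ X⟫ * (2 * ‖X₂ X‖)) := by
      linear_combination 2 * h2
    have h7 : ‖X₂ X‖ ^ 2 • A (-X) - ⟪A (-X), X₂ X⟫ • X₂ X =
        ‖X₂ X‖ ^ 2 • A X - ⟪A X, X₂ X⟫ • X₂ X := by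
      rw [h1, h5, real_inner_comm (A X) (X₂ X), two_mul, add_smul]
      abel
    rw [h6, h7]
  have hUtan : ∀ X, 0 ≤ X 0 → ∑ i, X i * U X i = 0 := by
    intro X h0
    have h1 : ∑ i : Fin (n + 1), X i.succ *
        ((|X 0| + ‖X₂ X‖) ^ 2 • A X - ⟪A X, X₂ X⟫ • X₂ X).ofLp i =
        ⟪(|X 0| + ‖X₂ X‖) ^ 2 • A X - ⟪A X, X₂ X⟫ • X₂ X, X₂ X⟫ := by
      rw [PiLp.inner_apply]
      rfl
    rw [Fin.sum_univ_succ]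
    simp only [hU, Fin.cons_zero, Fin.cons_succ]
    rw [h1, inner_sub_left, inner_smul_left, inner_smul_left, real_inner_self_eq_norm_sq,
      abs_of_nonneg h0]
    simp only [conj_trivial]
    ring
  have hUne : ∀ X, U X = 0 → X = 0 := by
    intro X hX
    have h0 := congrFun hX 0
    have h1 : (|X 0| + ‖X₂ X‖) ^ 2 • A X - ⟪A X, X₂ X⟫ • X₂ X = 0 := by
      ext i
      exact congrFun hX i.succ
    simp only [hU, Fin.cons_zero, Pi.zero_apply, neg_eq_zero, mul_eq_zero] at h0
    have hρ : |X 0| + ‖X₂ X‖ = 0 := by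
      rcases h0 with h0 | h0
      · rw [h0, zero_smul, sub_zero, smul_eq_zero] at h1
        rcases h1 with h1 | h1
        · exact pow_eq_zero_iff (two_ne_zero) |>.1 h1
        · have := hAnorm (X 0, X₂ X)
          rw [← this, norm_eq_zero]
          exact h1
      · linarith [abs_nonneg (X 0), norm_nonneg (X₂ X)]
    have hX0 : X 0 = 0 := abs_eq_zero.1 (by linarith [abs_nonneg (X 0), norm_nonneg (X₂ X)])
    have hXt : X₂ X = 0 := norm_eq_zero.1 (by linarith [abs_nonneg (X 0), norm_nonneg (X₂ X)])
    funext i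
    refine Fin.cases hX0 (fun i => ?_) i
    exact congrArg (fun v : Eu n => v i) hXt
  obtain ⟨X, hX, hVX⟩ := exists_zero_of_even_tangent
    (fun X => if 0 ≤ X 0 then U X else U (-X))
    (by
      refine continuous_if_le continuous_const (continuous_apply 0) hUc.continuousOn
        (hUc.comp continuous_neg).continuousOn fun X h => ?_
      exact (hUeven X h.symm).symm)
    (fun X => by
      simp only [Pi.neg_apply, neg_neg]
      split_ifs with h1 h2 h2
      · exact hUeven X (by linarith)
      · rfl
      · rfl
      · linarith)
    (fun X => by
      split_ifs with h
      · exact hUtan X h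
      · have := hUtan (-X) (by simp only [Pi.neg_apply]; linarith)
        simpa using this)
  split_ifs at hVX with h
  · exact hX (hUne X hVX)
  · exact hX (neg_eq_zero.1 (hUne _ hVX))

/-! ### The conformal maps on the unit sphere -/

lemma mem_sphSet {n : ℕ} {x : Eu n} : x ∈ sphSet n ↔ ‖x‖ = 1 := mem_sphere_zero_iff_norm

/-- The denominator `|x + ξ|²` of `d_ξ` on the unit sphere. -/
def den {n : ℕ} (ξ x : Eu n) : ℝ := 1 + 2 * ⟪ξ, x⟫ + ‖ξ‖ ^ 2

lemma den_pos {n : ℕ} {ξ x : Eu n} (hξ : ‖ξ‖ < 1) (hx : ‖x‖ = 1) : 0 < den ξ x := by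
  have h := neg_le_of_abs_le (abs_real_inner_le_norm ξ x)
  rw [hx, mul_one] at h
  have : 0 < (1 - ‖ξ‖) ^ 2 := pow_pos (by linarith) 2
  unfold den
  nlinarith

lemma dMap_eq {n : ℕ} (ξ : Eu n) {x : Eu n} (hx : ‖x‖ = 1) :
    dMap ξ x = (den ξ x)⁻¹ • ((1 - ‖ξ‖ ^ 2) • x + (2 + 2 * ⟪ξ, x⟫) • ξ) := by
  have h : 1 + 2 * ⟪ξ, x⟫ + (1 : ℝ) = 2 + 2 * ⟪ξ, x⟫ := by ring
  rw [dMap, den, hx, one_pow, one_mul, h]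

lemma den_smul_dMap {n : ℕ} {ξ x : Eu n} (hξ : ‖ξ‖ < 1) (hx : ‖x‖ = 1) :
    den ξ x • dMap ξ x = (1 - ‖ξ‖ ^ 2) • x + (2 + 2 * ⟪ξ, x⟫) • ξ := by
  rw [dMap_eq ξ hx, smul_smul, mul_inv_cancel₀ (den_pos hξ hx).ne', one_smul]

lemma norm_dMap {n : ℕ} {ξ x : Eu n} (hξ : ‖ξ‖ < 1) (hx : ‖x‖ = 1) : ‖dMap ξ x‖ = 1 := by
  have hd := den_pos hξ hx
  have h1 : (den ξ x * ‖dMap ξ x‖) ^ 2 = den ξ x ^ 2 := by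
    have h2 : den ξ x * ‖dMap ξ x‖ = ‖den ξ x • dMap ξ x‖ := by
      rw [norm_smul, Real.norm_eq_abs, abs_of_pos hd]
    rw [h2, den_smul_dMap hξ hx, ← real_inner_self_eq_norm_sq]
    simp only [inner_add_left, inner_add_right, inner_smul_left, inner_smul_right,
      real_inner_self_eq_norm_sq, conj_trivial, real_inner_comm ξ x, hx, den]
    ring
  have h3 := (pow_left_inj₀ (by positivity) hd.le two_ne_zero).1 h1
  exact mul_left_cancel₀ hd.ne' (by rw [h3, mul_one])

lemma den_mul_inner_dMap {n : ℕ} {ξ x : Eu n} (hξ : ‖ξ‖ < 1) (hx : ‖x‖ = 1) :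
    den ξ x * ⟪ξ, dMap ξ x⟫ = (1 - ‖ξ‖ ^ 2) * ⟪ξ, x⟫ + (2 + 2 * ⟪ξ, x⟫) * ‖ξ‖ ^ 2 := by
  rw [← real_inner_smul_right, den_smul_dMap hξ hx, inner_add_right, real_inner_smul_right,
    real_inner_smul_right, real_inner_self_eq_norm_sq]

lemma dMap_neg_dMap {n : ℕ} {ξ x : Eu n} (hξ : ‖ξ‖ < 1) (hx : ‖x‖ = 1) :
    dMap (-ξ) (dMap ξ x) = x := by
  have hξ' : ‖-ξ‖ < 1 := by rwa [norm_neg]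
  have hy := norm_dMap hξ hx
  have hi := den_mul_inner_dMap hξ hx
  have h0 : 1 - ‖ξ‖ ^ 2 ≠ 0 := by nlinarith [norm_nonneg ξ]
  have h1 : den ξ x * den (-ξ) (dMap ξ x) = (1 - ‖ξ‖ ^ 2) ^ 2 := by
    have : den (-ξ) (dMap ξ x) = 1 - 2 * ⟪ξ, dMap ξ x⟫ + ‖ξ‖ ^ 2 := by
      rw [den, inner_neg_left, norm_neg]
      ring
    rw [this, show den ξ x * (1 - 2 * ⟪ξ, dMap ξ x⟫ + ‖ξ‖ ^ 2) =
      den ξ x * (1 + ‖ξ‖ ^ 2) - 2 * (den ξ x * ⟪ξ, dMap ξ x⟫) by ring, hi, den]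
    ring
  have h2 : (1 - ‖ξ‖ ^ 2) ^ 2 • dMap (-ξ) (dMap ξ x) = (1 - ‖ξ‖ ^ 2) ^ 2 • x := by
    have h3 : den ξ x • (1 - ‖ξ‖ ^ 2) • dMap ξ x =
        (1 - ‖ξ‖ ^ 2) • ((1 - ‖ξ‖ ^ 2) • x + (2 + 2 * ⟪ξ, x⟫) • ξ) := by
      rw [smul_comm, den_smul_dMap hξ hx]
    conv_lhs => rw [← h1]
    rw [mul_smul, den_smul_dMap hξ' hy, norm_neg, smul_add, h3, inner_neg_left, smul_neg,
      smul_neg, smul_smul, show den ξ x * (2 + 2 * -⟪ξ, dMap ξ x⟫) =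
        2 * den ξ x - 2 * (den ξ x * ⟪ξ, dMap ξ x⟫) by ring, hi, den]
    module
  exact smul_right_injective _ (pow_ne_zero 2 h0) h2

lemma dMap_dMap_neg {n : ℕ} {ξ x : Eu n} (hξ : ‖ξ‖ < 1) (hx : ‖x‖ = 1) :
    dMap ξ (dMap (-ξ) x) = x := by
  have := dMap_neg_dMap (ξ := -ξ) (by rwa [norm_neg]) hx
  rwa [neg_neg] at this

lemma dMap_zero {n : ℕ} (x : Eu n) : dMap 0 x = x := by
  simp [dMap]

lemma measurable_dMap {n : ℕ} (ξ : Eu n) : Measurable (dMap ξ) := by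
  unfold dMap
  fun_prop

lemma continuousOn_dMap {n : ℕ} {X : Type*} [TopologicalSpace X] {s : Set X} {f g : X → Eu n}
    (hf : ContinuousOn f s) (hg : ContinuousOn g s) (hf1 : ∀ x ∈ s, ‖f x‖ < 1)
    (hg1 : ∀ x ∈ s, ‖g x‖ = 1) : ContinuousOn (fun x => dMap (f x) (g x)) s := by
  have h : ContinuousOn (fun x => (den (f x) (g x))⁻¹ •
      ((1 - ‖f x‖ ^ 2) • g x + (2 + 2 * ⟪f x, g x⟫) • f x)) s := by
    have hd : ContinuousOn (fun x => den (f x) (g x)) s := by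
      unfold den
      fun_prop
    refine (hd.inv₀ fun x hx => (den_pos (hf1 x hx) (hg1 x hx)).ne').smul ?_
    fun_prop
  exact h.congr fun x hx => dMap_eq _ (hg1 x hx)

lemma inner_Refl_left {n : ℕ} (p x : Eu n) (y : Eu n) :
    ⟪Refl p x, y⟫ = ⟪x, y⟫ - 2 * ⟪p, x⟫ * ⟪p, y⟫ := by
  rw [Refl, inner_sub_left, real_inner_smul_left]

lemma inner_Refl_self {n : ℕ} {p : Eu n} (hp : ‖p‖ = 1) (x : Eu n) :
    ⟪p, Refl p x⟫ = -⟪p, x⟫ := by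
  rw [real_inner_comm, inner_Refl_left, real_inner_self_eq_norm_sq, hp, real_inner_comm]
  ring

lemma Refl_Refl {n : ℕ} {p : Eu n} (hp : ‖p‖ = 1) (x : Eu n) : Refl p (Refl p x) = x := by
  rw [Refl, inner_Refl_self hp, Refl]
  module

lemma inner_Refl_Refl {n : ℕ} {p : Eu n} (hp : ‖p‖ = 1) (x y : Eu n) :
    ⟪Refl p x, Refl p y⟫ = ⟪x, y⟫ := by
  rw [inner_Refl_left, inner_Refl_self hp, real_inner_comm, inner_Refl_left, real_inner_comm]
  ring

lemma norm_Refl {n : ℕ} {p : Eu n} (hp : ‖p‖ = 1) (x : Eu n) : ‖Refl p x‖ = ‖x‖ := by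
  rw [norm_eq_sqrt_real_inner, inner_Refl_Refl hp, ← norm_eq_sqrt_real_inner]

lemma Refl_neg_left {n : ℕ} (p : Eu n) : Refl (-p) = Refl p := by
  funext x
  simp [Refl]

lemma Refl_dMap {n : ℕ} {p : Eu n} (hp : ‖p‖ = 1) (ξ x : Eu n) :
    Refl p (dMap ξ x) = dMap (Refl p ξ) (Refl p x) := by
  have hlin : ∀ (a b : ℝ) (u v : Eu n),
      Refl p (a • u + b • v) = a • Refl p u + b • Refl p v := by
    intro a b u v
    simp only [Refl, inner_add_right, real_inner_smul_right]
    module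
  have hsmul : ∀ (a : ℝ) (u : Eu n), Refl p (a • u) = a • Refl p u := by
    intro a u
    simpa using hlin a 0 u 0
  rw [dMap, dMap, hsmul, hlin, inner_Refl_Refl hp, norm_Refl hp, norm_Refl hp]

lemma continuous_Refl {n : ℕ} : Continuous fun q : Eu n × Eu n => Refl q.1 q.2 := by
  unfold Refl
  fun_prop

lemma measurable_tauMap {n : ℕ} (r : ℝ) (p : Eu n) : Measurable (tauMap r p) :=
  (measurable_dMap _).comp
    ((continuous_Refl.comp (by fun_prop : Continuous fun x => (p, x))).measurable.comp
      (measurable_dMap _))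

lemma norm_smul_lt_one {n : ℕ} {r : ℝ} {p : Eu n} (hr : r ∈ Set.Ioo (-1 : ℝ) 1)
    (hp : ‖p‖ = 1) : ‖r • p‖ < 1 := by
  rw [norm_smul, hp, mul_one]
  exact abs_lt.2 hr

lemma norm_tauMap {n : ℕ} {r : ℝ} {p x : Eu n} (hr : r ∈ Set.Ioo (-1 : ℝ) 1)
    (hp : ‖p‖ = 1) (hx : ‖x‖ = 1) : ‖tauMap r p x‖ = 1 := by
  have h := norm_smul_lt_one hr hp
  refine norm_dMap h ?_
  rw [Function.comp_apply, norm_Refl hp, norm_dMap (by rwa [norm_neg]) hx]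

lemma dMap_neg_tauMap {n : ℕ} {r : ℝ} {p x : Eu n} (hr : r ∈ Set.Ioo (-1 : ℝ) 1)
    (hp : ‖p‖ = 1) (hx : ‖x‖ = 1) :
    dMap (-(r • p)) (tauMap r p x) = Refl p (dMap (-(r • p)) x) := by
  have h := norm_smul_lt_one hr hp
  refine dMap_neg_dMap h ?_
  rw [Function.comp_apply, norm_Refl hp, norm_dMap (by rwa [norm_neg]) hx]

lemma tauMap_tauMap {n : ℕ} {r : ℝ} {p x : Eu n} (hr : r ∈ Set.Ioo (-1 : ℝ) 1)
    (hp : ‖p‖ = 1) (hx : ‖x‖ = 1) : tauMap r p (tauMap r p x) = x := by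
  have h := norm_smul_lt_one hr hp
  rw [tauMap, Function.comp_apply, Function.comp_apply]
  change dMap (r • p) (Refl p (dMap (-(r • p)) (tauMap r p x))) = x
  rw [dMap_neg_tauMap hr hp hx, Refl_Refl hp, dMap_dMap_neg h hx]

lemma tauMap_neg_neg {n : ℕ} (r : ℝ) (p : Eu n) : tauMap (-r) (-p) = tauMap r p := by
  rw [tauMap, tauMap, neg_smul_neg, Refl_neg_left]

lemma cap_eq {n : ℕ} {r : ℝ} {p : Eu n} (hr : r ∈ Set.Ioo (-1 : ℝ) 1) (hp : ‖p‖ = 1) :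
    cap n r p = {x | ‖x‖ = 1 ∧ 0 < ⟪p, dMap (-(r • p)) x⟫} := by
  have h := norm_smul_lt_one hr hp
  ext x
  constructor
  · rintro ⟨y, ⟨hy, hpy⟩, rfl⟩
    rw [mem_sphSet] at hy
    exact ⟨norm_dMap h hy, by rwa [dMap_neg_dMap h hy]⟩
  · rintro ⟨hx, hpx⟩
    exact ⟨dMap (-(r • p)) x, ⟨mem_sphSet.2 (norm_dMap (by rwa [norm_neg]) hx), hpx⟩,
      dMap_dMap_neg h hx⟩

lemma measurableSet_cap {n : ℕ} {r : ℝ} {p : Eu n} (hr : r ∈ Set.Ioo (-1 : ℝ) 1)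
    (hp : ‖p‖ = 1) : MeasurableSet (cap n r p) := by
  rw [cap_eq hr hp]
  refine (measurableSet_eq_fun measurable_norm measurable_const).inter ?_
  have hc : Continuous fun y : Eu n => ⟪p, y⟫ := by fun_prop
  exact measurableSet_lt measurable_const (hc.measurable.comp (measurable_dMap _))

lemma tauMap_mem_cap_iff {n : ℕ} {r : ℝ} {p x : Eu n} (hr : r ∈ Set.Ioo (-1 : ℝ) 1)
    (hp : ‖p‖ = 1) (hx : ‖x‖ = 1) : tauMap r p x ∈ cap n (-r) (-p) ↔ x ∈ cap n r p := by
  have hr' : -r ∈ Set.Ioo (-1 : ℝ) 1 := ⟨by linarith [hr.2], by linarith [hr.1]⟩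
  rw [cap_eq hr hp, cap_eq hr' (by rwa [norm_neg])]
  simp only [Set.mem_ofPred_eq, norm_tauMap hr hp hx, hx, true_and, neg_smul_neg,
    dMap_neg_tauMap hr hp hx, inner_neg_left, inner_Refl_self hp, neg_neg]

/-! ### Möbius maps of the unit sphere -/

/-- `φ` is, on the unit sphere, the quotient of an affine map by a positive affine function. -/
def IsMob {n : ℕ} (φ : Eu n → Eu n) (A : ℝ) (b : Eu n) (M : Eu n →ₗ[ℝ] Eu n) (c : Eu n) :
    Prop :=
  ∀ x : Eu n, ‖x‖ = 1 → 0 < A + ⟪b, x⟫ ∧ ‖φ x‖ = 1 ∧ (A + ⟪b, x⟫) • φ x = M x + c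

/-- The linear part of the numerator of `d_ξ` on the unit sphere. -/
def dLin {n : ℕ} (ξ : Eu n) : Eu n →ₗ[ℝ] Eu n :=
  (1 - ‖ξ‖ ^ 2) • LinearMap.id + ((2 : ℝ) • (innerₛₗ ℝ ξ)).smulRight ξ

lemma dLin_apply {n : ℕ} (ξ x : Eu n) :
    dLin ξ x = (1 - ‖ξ‖ ^ 2) • x + (2 * ⟪ξ, x⟫) • ξ := rfl

lemma isMob_dMap {n : ℕ} {ξ : Eu n} (hξ : ‖ξ‖ < 1) :
    IsMob (dMap ξ) (1 + ‖ξ‖ ^ 2) ((2 : ℝ) • ξ) (dLin ξ) ((2 : ℝ) • ξ) := by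
  intro x hx
  have hd : 1 + ‖ξ‖ ^ 2 + ⟪(2 : ℝ) • ξ, x⟫ = den ξ x := by
    rw [den, real_inner_smul_left]
    ring
  refine ⟨hd ▸ den_pos hξ hx, norm_dMap hξ hx, ?_⟩
  rw [hd, den_smul_dMap hξ hx, dLin_apply]
  module

lemma isMob_Refl {n : ℕ} {p : Eu n} (hp : ‖p‖ = 1) :
    IsMob (Refl p) 1 0 (LinearMap.id - ((2 : ℝ) • (innerₛₗ ℝ p)).smulRight p) 0 := by
  intro x hx
  refine ⟨by simp, by rw [norm_Refl hp, hx], ?_⟩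
  rw [inner_zero_left, add_zero, one_smul, add_zero]
  rfl

lemma IsMob.comp {n : ℕ} {φ ψ : Eu n → Eu n} {A A' : ℝ} {b b' c c' : Eu n}
    {M M' : Eu n →ₗ[ℝ] Eu n} (hφ : IsMob φ A b M c) (hψ : IsMob ψ A' b' M' c') :
    IsMob (φ ∘ ψ) (A * A' + ⟪b, c'⟫) (A • b' + LinearMap.adjoint M' b)
      (M ∘ₗ M' + (innerₛₗ ℝ b').smulRight c) (M c' + A' • c) := by
  intro x hx
  obtain ⟨h1, h2, h3⟩ := hψ x hx
  obtain ⟨k1, k2, k3⟩ := hφ _ h2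
  have hd : A * A' + ⟪b, c'⟫ + ⟪A • b' + LinearMap.adjoint M' b, x⟫ =
      (A' + ⟪b', x⟫) * (A + ⟪b, ψ x⟫) := by
    have : (A' + ⟪b', x⟫) * ⟪b, ψ x⟫ = ⟪b, M' x⟫ + ⟪b, c'⟫ := by
      rw [← real_inner_smul_right, h3, inner_add_right]
    rw [mul_add, this, inner_add_left, LinearMap.adjoint_inner_left, real_inner_smul_left]
    ring
  refine ⟨hd ▸ mul_pos h1 k1, k2, ?_⟩
  rw [hd, mul_smul, Function.comp_apply, k3, smul_add, ← map_smul, h3, map_add]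
  simp only [LinearMap.add_apply, LinearMap.comp_apply, LinearMap.smulRight_apply,
    innerₛₗ_apply_apply]
  module

lemma exists_unit_orthogonal {n : ℕ} (hn : 1 ≤ n) (b : Eu n) :
    ∃ x : Eu n, ‖x‖ = 1 ∧ ⟪b, x⟫ = 0 := by
  have hne : (ℝ ∙ b)ᗮ ≠ ⊥ := by
    intro h
    have h1 := Submodule.finrank_add_finrank_orthogonal (ℝ ∙ b)
    rw [h, finrank_bot, finrank_euclideanSpace_fin] at h1
    have := finrank_span_finset_le_card (R := ℝ) ({b} : Finset (Eu n))
    rw [Finset.coe_singleton, Finset.card_singleton, Set.finrank] at this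
    omega
  obtain ⟨y, hy, hy0⟩ := Submodule.exists_mem_ne_zero_of_ne_bot hne
  refine ⟨‖y‖⁻¹ • y, norm_smul_inv_norm hy0, ?_⟩
  rw [real_inner_smul_right, Submodule.mem_orthogonal_singleton_iff_inner_right.1 hy, mul_zero]

/-- If a Möbius map is linear on the sphere, its denominator is constant. -/
lemma IsMob.inner_eq_zero_of_linear {n : ℕ} (hn : 1 ≤ n) {φ : Eu n → Eu n} {A : ℝ}
    {b c : Eu n} {M : Eu n →ₗ[ℝ] Eu n} (hφ : IsMob φ A b M c)
    (hodd : ∀ x : Eu n, ‖x‖ = 1 → φ (-x) = -φ x) (x : Eu n) (hx : ‖x‖ = 1) : ⟪b, x⟫ = 0 := by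
  have key : ∀ y : Eu n, ‖y‖ = 1 → ⟪b, y⟫ • φ y = c := by
    intro y hy
    have h1 := (hφ y hy).2.2
    have h2 := (hφ (-y) (by rwa [norm_neg])).2.2
    rw [hodd y hy, inner_neg_right, map_neg] at h2
    have h3 : (2 : ℝ) • ⟪b, y⟫ • φ y = (2 : ℝ) • c := by
      calc (2 : ℝ) • ⟪b, y⟫ • φ y = (A + ⟪b, y⟫) • φ y + (A + -⟪b, y⟫) • -φ y := by module
        _ = (2 : ℝ) • c := by
          rw [h1, h2]
          module
    exact smul_right_injective _ two_ne_zero h3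
  obtain ⟨y, hy, hby⟩ := exists_unit_orthogonal hn b
  have hc : c = 0 := by rw [← key y hy, hby, zero_smul]
  have h := key x hx
  rw [hc, smul_eq_zero] at h
  refine h.resolve_right fun h0 => ?_
  have := (hφ x hx).2.1
  rw [h0, norm_zero] at this
  exact zero_ne_one this

/-- An injective affine map of the unit sphere to itself is linear. -/
lemma linear_of_affine {n : ℕ} {φ : Eu n → Eu n} (M : Eu n →ₗ[ℝ] Eu n) (c : Eu n)
    (hφ : ∀ x : Eu n, ‖x‖ = 1 → φ x = M x + c) (hφ1 : ∀ x : Eu n, ‖x‖ = 1 → ‖φ x‖ = 1)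
    (hinj : ∀ x y : Eu n, ‖x‖ = 1 → ‖y‖ = 1 → φ x = φ y → x = y) : c = 0 := by
  have h1 : ∀ x : Eu n, ‖x‖ = 1 → ⟪M x, c⟫ = 0 := by
    intro x hx
    have hx' : ‖-x‖ = 1 := by rwa [norm_neg]
    have e1 := hφ1 x hx
    have e2 := hφ1 (-x) hx'
    rw [hφ x hx] at e1
    rw [hφ _ hx', map_neg] at e2
    have f1 := norm_add_sq_real (M x) c
    have f2 := norm_add_sq_real (-M x) c
    rw [e1] at f1
    rw [e2, norm_neg, inner_neg_left] at f2
    linarith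
  have hinjM : Function.Injective M := by
    rw [injective_iff_map_eq_zero]
    intro x hx
    by_contra hx0
    have hu : ‖‖x‖⁻¹ • x‖ = 1 := norm_smul_inv_norm hx0
    have hu' : ‖-(‖x‖⁻¹ • x)‖ = 1 := by rwa [norm_neg]
    have h2 : φ (‖x‖⁻¹ • x) = φ (-(‖x‖⁻¹ • x)) := by
      rw [hφ _ hu, hφ _ hu', map_neg, map_smul, hx, smul_zero, neg_zero]
    have h3 := hinj _ _ hu hu' h2
    have h4 : ‖x‖⁻¹ • x = 0 := by
      have := add_eq_zero_iff_eq_neg.2 h3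
      rw [← two_smul ℝ, smul_eq_zero] at this
      exact this.resolve_left two_ne_zero
    rw [h4, norm_zero] at hu
    exact zero_ne_one hu
  obtain ⟨z, hz⟩ := LinearMap.injective_iff_surjective.1 hinjM c
  by_contra hc
  have hz0 : z ≠ 0 := by
    rintro rfl
    exact hc (by rw [← hz, map_zero])
  have h5 := h1 (‖z‖⁻¹ • z) (norm_smul_inv_norm hz0)
  rw [map_smul, hz, real_inner_smul_left] at h5
  rcases mul_eq_zero.1 h5 with h | h
  · exact hz0 (norm_eq_zero.1 (inv_eq_zero.1 h))
  · exact hc (inner_self_eq_zero.1 h)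

/-- An injective Möbius map is the composition of some `d_η` with a linear isometry. -/
lemma IsMob.exists_decomp {n : ℕ} {φ : Eu n → Eu n} {A : ℝ} {b c : Eu n}
    {M : Eu n →ₗ[ℝ] Eu n} (hφ : IsMob φ A b M c)
    (hinj : ∀ x y : Eu n, ‖x‖ = 1 → ‖y‖ = 1 → φ x = φ y → x = y) :
    ∃ η : Eu n, ‖η‖ < 1 ∧ ∃ T : Eu n →ₗᵢ[ℝ] Eu n,
      ∀ x : Eu n, ‖x‖ = 1 → φ x = T (dMap η x) := by
  have hAb : ‖b‖ < A := by
    by_cases hb : b = 0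
    · obtain ⟨y, hy⟩ := exists_norm_eq (Eu n) (zero_le_one' ℝ)
      have := (hφ y hy).1
      simpa [hb] using this
    · have hu : ‖-(‖b‖⁻¹ • b)‖ = 1 := by
        rw [norm_neg]
        exact norm_smul_inv_norm hb
      have := (hφ _ hu).1
      rw [inner_neg_right, real_inner_smul_right, real_inner_self_eq_norm_sq, pow_two,
        inv_mul_cancel_left₀ (norm_ne_zero_iff.2 hb)] at this
      linarith
  have hA : 0 < A := (norm_nonneg b).trans_lt hAb
  have hB : 0 < A ^ 2 - ‖b‖ ^ 2 := by nlinarith [norm_nonneg b]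
  set d := √(A ^ 2 - ‖b‖ ^ 2) with hd
  have hd0 : 0 < d := Real.sqrt_pos.2 hB
  have hd2 : d ^ 2 = A ^ 2 - ‖b‖ ^ 2 := Real.sq_sqrt hB.le
  set k := (A + d)⁻¹ with hk
  have hk0 : 0 < k := by positivity
  have hk1 : k * (A + d) = 1 := inv_mul_cancel₀ (by positivity)
  have hkeq : k ^ 2 * ‖b‖ ^ 2 - 2 * A * k + 1 = 0 := by
    have : ‖b‖ ^ 2 = (A - d) * (A + d) := by linarith
    rw [this]
    linear_combination (k * (A - d) - 1) * hk1
  have hη : ‖k • b‖ < 1 := by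
    rw [norm_smul, Real.norm_eq_abs, abs_of_pos hk0, ← hk1]
    exact mul_lt_mul_of_pos_left (by linarith) hk0
  have hη' : ‖-(k • b)‖ < 1 := by rwa [norm_neg]
  have hcomp := hφ.comp (isMob_dMap hη')
  set A₀ := A * (1 + ‖-(k • b)‖ ^ 2) + ⟪b, (2 : ℝ) • -(k • b)⟫ with hA₀
  set b₀ := A • (2 : ℝ) • -(k • b) + LinearMap.adjoint (dLin (-(k • b))) b with hb₀
  set M₀ := M ∘ₗ dLin (-(k • b)) + (innerₛₗ ℝ ((2 : ℝ) • -(k • b))).smulRight c with hM₀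
  set c₀ := M ((2 : ℝ) • -(k • b)) + (1 + ‖-(k • b)‖ ^ 2) • c with hc₀
  have hb0 : ∀ x, ⟪b₀, x⟫ = 0 := by
    intro x
    rw [hb₀, inner_add_left, LinearMap.adjoint_inner_left, dLin_apply]
    simp only [inner_add_right, real_inner_smul_left, real_inner_smul_right, inner_neg_left,
      inner_neg_right, norm_neg, norm_smul, real_inner_self_eq_norm_sq, mul_pow, norm_eq_abs,
      sq_abs]
    linear_combination ⟪b, x⟫ * hkeq
  have hA0 : 0 < A₀ := by
    obtain ⟨y, hy⟩ := exists_norm_eq (Eu n) (zero_le_one' ℝ)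
    have := (hcomp y hy).1
    rwa [hb0, add_zero] at this
  have haff : ∀ x : Eu n, ‖x‖ = 1 →
      φ (dMap (-(k • b)) x) = (A₀⁻¹ • M₀) x + A₀⁻¹ • c₀ := by
    intro x hx
    have h := (hcomp x hx).2.2
    rw [hb0, add_zero] at h
    rw [LinearMap.smul_apply, ← smul_add, ← h, smul_smul, inv_mul_cancel₀ hA0.ne', one_smul]
    rfl
  have hnorm : ∀ x : Eu n, ‖x‖ = 1 → ‖φ (dMap (-(k • b)) x)‖ = 1 :=
    fun x hx => (hcomp x hx).2.1
  have hc0 := linear_of_affine _ _ haff hnorm (fun x y hx hy h => by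
    have := hinj _ _ (norm_dMap hη' hx) (norm_dMap hη' hy) h
    rw [← dMap_dMap_neg hη hx, this, dMap_dMap_neg hη hy])
  rw [hc0] at haff
  refine ⟨k • b, hη, ⟨A₀⁻¹ • M₀, fun x => ?_⟩, fun x hx => ?_⟩
  · by_cases hx : x = 0
    · simp [hx]
    have h1 := hnorm _ (norm_smul_inv_norm (𝕜 := ℝ) hx)
    rw [haff _ (norm_smul_inv_norm (𝕜 := ℝ) hx), add_zero, map_smul, norm_smul, norm_inv] at h1
    simp only [RCLike.ofReal_real_eq_id, id_eq, norm_norm] at h1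
    exact (inv_mul_eq_one₀ (norm_ne_zero_iff.2 hx)).1 h1 |>.symm
  · have := haff _ (norm_dMap hη hx)
    rwa [dMap_neg_dMap hη hx, add_zero] at this

/-- If `d_ξ ∘ d_{-ζ}` is odd on the sphere then `ξ = ζ`. -/
lemma eq_of_dMap_odd {n : ℕ} (hn : 1 ≤ n) {ξ ζ : Eu n} (hξ : ‖ξ‖ < 1) (hζ : ‖ζ‖ < 1)
    (hodd : ∀ x : Eu n, ‖x‖ = 1 →
      dMap ξ (dMap (-ζ) (-x)) = -dMap ξ (dMap (-ζ) x)) : ξ = ζ := by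
  have hζ' : ‖-ζ‖ < 1 := by rwa [norm_neg]
  have h1 := (((isMob_dMap hξ).comp (isMob_dMap hζ')).inner_eq_zero_of_linear hn hodd)
  have h2 : ∀ x : Eu n,
      ⟪(1 - ‖ζ‖ ^ 2) • ξ - (1 + ‖ξ‖ ^ 2 - 2 * ⟪ξ, ζ⟫) • ζ, x⟫ = 0 := by
    have h3 : ∀ x : Eu n, ‖x‖ = 1 →
        ⟪(1 - ‖ζ‖ ^ 2) • ξ - (1 + ‖ξ‖ ^ 2 - 2 * ⟪ξ, ζ⟫) • ζ, x⟫ = 0 := by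
      intro x hx
      have h := h1 x hx
      rw [inner_add_left, LinearMap.adjoint_inner_left, dLin_apply] at h
      simp only [inner_add_right, real_inner_smul_left, real_inner_smul_right, inner_neg_left,
        inner_neg_right, norm_neg] at h
      rw [inner_sub_left, real_inner_smul_left, real_inner_smul_left]
      linarith
    intro x
    by_cases hx : x = 0
    · rw [hx, inner_zero_right]
    · have h := h3 _ (norm_smul_inv_norm (𝕜 := ℝ) hx)
      rw [real_inner_smul_right] at h
      refine (mul_eq_zero.1 h).resolve_left ?_
      simpa using hx
  have h4 : (1 - ‖ζ‖ ^ 2) • ξ = (1 + ‖ξ‖ ^ 2 - 2 * ⟪ξ, ζ⟫) • ζ :=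
    sub_eq_zero.1 (inner_self_eq_zero.1 (h2 _))
  have hs : 0 < 1 - ‖ζ‖ ^ 2 := by nlinarith [norm_nonneg ζ]
  obtain ⟨k, rfl⟩ : ∃ k : ℝ, ξ = k • ζ := by
    refine ⟨(1 - ‖ζ‖ ^ 2)⁻¹ * (1 + ‖ξ‖ ^ 2 - 2 * ⟪ξ, ζ⟫), ?_⟩
    rw [mul_smul, ← h4, smul_smul, inv_mul_cancel₀ hs.ne', one_smul]
  by_cases hz : ζ = 0
  · rw [hz, smul_zero]
  rw [smul_smul] at h4
  have h5 := smul_left_injective ℝ hz h4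
  simp only [norm_smul, mul_pow, norm_eq_abs, sq_abs, real_inner_smul_left,
    real_inner_self_eq_norm_sq] at h5
  have h6 : (k * ‖ζ‖ ^ 2 - 1) * (k - 1) = 0 := by linear_combination -h5
  rcases mul_eq_zero.1 h6 with h | h
  · exfalso
    rw [norm_smul, norm_eq_abs] at hξ
    have h7 : |k| * ‖ζ‖ * ‖ζ‖ = 1 := by
      have hk : 0 < k := by
        by_contra hk
        nlinarith [sq_nonneg ‖ζ‖]
      rw [abs_of_pos hk]
      linarith
    have h8 : |k| * ‖ζ‖ * ‖ζ‖ ≤ |k| * ‖ζ‖ :=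
      mul_le_of_le_one_right (by positivity) hζ.le
    linarith
  · rw [sub_eq_zero.1 h, one_smul]

/-! ### Measures on the unit sphere -/

/-- A finite measure carried by the unit sphere and without atoms. -/
structure IsSph {n : ℕ} (μ : Measure (Eu n)) : Prop where
  finite : IsFiniteMeasure μ
  norm_eq : ∀ᵐ x ∂μ, ‖x‖ = 1
  singleton : ∀ x : Eu n, μ {x} = 0

open scoped Pointwise in
lemma toSphere_singleton {n : ℕ} (hn : 1 ≤ n) (x : sphere (0 : Eu n) 1) :
    (volume : Measure (Eu n)).toSphere {x} = 0 := by
  rw [Measure.toSphere_apply' _ (measurableSet_singleton x), Set.image_singleton]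
  have h : (volume : Measure (Eu n)) (Set.Ioo (0 : ℝ) 1 • {(x : Eu n)}) = 0 := by
    refine measure_mono_null ?_ (Measure.addHaar_submodule volume (ℝ ∙ (x : Eu n)) ?_)
    · rintro _ ⟨t, -, y, hy, rfl⟩
      rw [Set.mem_singleton_iff.1 hy]
      exact Submodule.smul_mem _ _ (Submodule.mem_span_singleton_self _)
    · intro h
      obtain ⟨y, hy, hxy⟩ := exists_unit_orthogonal hn (x : Eu n)
      have hmem : y ∈ (ℝ ∙ (x : Eu n)) := by rw [h]; trivial
      obtain ⟨t, rfl⟩ := Submodule.mem_span_singleton.1 hmem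
      have hx1 : ‖(x : Eu n)‖ = 1 := mem_sphere_zero_iff_norm.1 x.2
      rw [real_inner_smul_right, real_inner_self_eq_norm_sq, hx1] at hxy
      rw [norm_smul, hx1, show t = 0 by linarith, norm_zero, zero_mul] at hy
      exact zero_ne_one hy
  rw [h, mul_zero]

lemma isSph_confMeasure {n : ℕ} (hn : 1 ≤ n) {w : Eu n → ℝ}
    (hvol : confMeasure n w Set.univ = 1) : IsSph (confMeasure n w) := by
  have hac : confMeasure n w ≪ sphMeasure n := withDensity_absolutelyContinuous _ _
  refine ⟨⟨by rw [hvol]; exact ENNReal.one_lt_top⟩, hac ?_, fun x => hac ?_⟩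
  · have hm : MeasurableSet {x : Eu n | ¬ ‖x‖ = 1} :=
      (measurableSet_eq_fun measurable_norm measurable_const).compl
    change sphMeasure n {x : Eu n | ¬ ‖x‖ = 1} = 0
    rw [sphMeasure, Measure.map_apply measurable_subtype_coe hm]
    convert! measure_empty (μ := (volume : Measure (Eu n)).toSphere)
    ext x
    simp
  · rw [sphMeasure, Measure.map_apply measurable_subtype_coe (measurableSet_singleton x)]
    by_cases hx : ‖x‖ = 1
    · convert! toSphere_singleton hn ⟨x, mem_sphere_zero_iff_norm.2 hx⟩
      ext y
      simp [Subtype.ext_iff]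
    · convert! measure_empty (μ := (volume : Measure (Eu n)).toSphere)
      ext y
      simp only [Set.mem_preimage, Set.mem_singleton_iff, Set.mem_empty_iff_false, iff_false]
      rintro rfl
      exact hx (mem_sphere_zero_iff_norm.1 y.2)

lemma IsSph.map {n : ℕ} {μ : Measure (Eu n)} (hμ : IsSph μ) {f : Eu n → Eu n}
    (hf : Measurable f) (hf1 : ∀ x, ‖x‖ = 1 → ‖f x‖ = 1)
    (hinj : ∀ x y : Eu n, ‖x‖ = 1 → ‖y‖ = 1 → f x = f y → x = y) : IsSph (μ.map f) := by
  have := hμ.finite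
  refine ⟨inferInstance, ?_, fun y => ?_⟩
  · rw [ae_map_iff hf.aemeasurable (measurableSet_eq_fun measurable_norm measurable_const)]
    exact hμ.norm_eq.mono hf1
  · rw [Measure.map_apply hf (measurableSet_singleton y)]
    have h : μ ({x | ‖x‖ = 1} ∩ f ⁻¹' {y}) = 0 := by
      have hsub : ({x | ‖x‖ = 1} ∩ f ⁻¹' {y}).Subsingleton := by
        rintro a ⟨ha, ha'⟩ b ⟨hb, hb'⟩
        exact hinj a b ha hb (Eq.trans ha' (Eq.symm hb'))
      rcases hsub.eq_empty_or_singleton with h | ⟨a, h⟩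
      · rw [h, measure_empty]
      · rw [h, hμ.singleton]
    refine measure_mono_null (t := {x | ¬ ‖x‖ = 1} ∪ ({x | ‖x‖ = 1} ∩ f ⁻¹' {y})) ?_
      (measure_union_null hμ.norm_eq h)
    intro x hx
    by_cases h1 : ‖x‖ = 1
    · exact Or.inr ⟨h1, hx⟩
    · exact Or.inl h1

lemma IsSph.add {n : ℕ} {μ ν : Measure (Eu n)} (hμ : IsSph μ) (hν : IsSph ν) :
    IsSph (μ + ν) := by
  have := hμ.finite
  have := hν.finite
  refine ⟨inferInstance, ae_add_measure_iff.2 ⟨hμ.norm_eq, hν.norm_eq⟩, fun x => ?_⟩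
  rw [Measure.add_apply, hμ.singleton, hν.singleton, add_zero]

lemma IsSph.restrict {n : ℕ} {μ : Measure (Eu n)} (hμ : IsSph μ) (s : Set (Eu n)) :
    IsSph (μ.restrict s) := by
  have := hμ.finite
  exact ⟨inferInstance, ae_restrict_of_ae hμ.norm_eq,
    fun x => Measure.absolutelyContinuous_of_le Measure.restrict_le_self (hμ.singleton x)⟩

lemma isSph_capMeasure {n : ℕ} {w : Eu n → ℝ} (hw : IsSph (confMeasure n w)) {r : ℝ}
    {p : Eu n} (hr : r ∈ Set.Ioo (-1 : ℝ) 1) (hp : ‖p‖ = 1) : IsSph (capMeasure n w r p) := by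
  refine (hw.add (hw.map (measurable_tauMap r p) (fun x => norm_tauMap hr hp) ?_)).restrict _
  intro x y hx hy h
  rw [← tauMap_tauMap hr hp hx, h, tauMap_tauMap hr hp hy]

/-- The measures of symmetric caps are exchanged by the conformal reflection. -/
lemma capMeasure_neg_neg {n : ℕ} {w : Eu n → ℝ} (hw : IsSph (confMeasure n w)) {r : ℝ}
    {p : Eu n} (hr : r ∈ Set.Ioo (-1 : ℝ) 1) (hp : ‖p‖ = 1) :
    capMeasure n w (-r) (-p) = (capMeasure n w r p).map (tauMap r p) := by
  have hτ := measurable_tauMap r p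
  have hr' : -r ∈ Set.Ioo (-1 : ℝ) 1 := ⟨by linarith [hr.2], by linarith [hr.1]⟩
  have hτ2 : ((confMeasure n w).map (tauMap r p)).map (tauMap r p) = confMeasure n w := by
    rw [Measure.map_map hτ hτ]
    conv_rhs => rw [← Measure.map_id (μ := confMeasure n w)]
    exact Measure.map_congr (hw.norm_eq.mono fun x hx => tauMap_tauMap hr hp hx)
  have hm : IsSph (confMeasure n w + (confMeasure n w).map (tauMap r p)) := by
    refine hw.add (hw.map hτ (fun x => norm_tauMap hr hp) fun x y hx hy h => ?_)
    rw [← tauMap_tauMap hr hp hx, h, tauMap_tauMap hr hp hy]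
  have hset : (cap n r p : Set (Eu n))
      =ᵐ[confMeasure n w + (confMeasure n w).map (tauMap r p)]
        tauMap r p ⁻¹' cap n (-r) (-p) :=
    hm.norm_eq.mono fun x hx => propext (tauMap_mem_cap_iff hr hp hx).symm
  rw [capMeasure, capMeasure, tauMap_neg_neg, Measure.restrict_congr_set hset,
    ← Measure.restrict_map hτ (measurableSet_cap hr' (by rwa [norm_neg])),
    Measure.map_add _ _ hτ, hτ2, add_comm (confMeasure n w)]

/-- Renormalization points are unique: if `ν` and its image under `d_η` are both centred
at the origin, then `η = 0`. -/
lemma eq_zero_of_centered {n : ℕ} {ν : Measure (Eu n)} (hν : IsSph ν) (hν0 : ν ≠ 0)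
    {η : Eu n} (hη : ‖η‖ < 1) (h1 : ∫ y, ⟪η, y⟫ ∂ν = 0)
    (h2 : ∫ y, ⟪η, dMap η y⟫ ∂ν = 0) : η = 0 := by
  have := hν.finite
  have hpos : ∀ y : Eu n, ‖y‖ = 1 → den η y * (⟪η, dMap η y⟫ - ⟪η, y⟫) =
      2 * (‖η‖ ^ 2 - ⟪η, y⟫ ^ 2) := by
    intro y hy
    rw [mul_sub, den_mul_inner_dMap hη hy, den]
    ring
  have hcs : ∀ y : Eu n, ‖y‖ = 1 → ⟪η, y⟫ ^ 2 ≤ ‖η‖ ^ 2 := by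
    intro y hy
    have h := abs_real_inner_le_norm η y
    rw [hy, mul_one] at h
    exact sq_le_sq' (neg_le_of_abs_le h) (le_of_abs_le h)
  have hi1 : Integrable (fun y => ⟪η, y⟫) ν := by
    have hc : Continuous fun y : Eu n => ⟪η, y⟫ := by fun_prop
    refine Integrable.of_bound hc.aestronglyMeasurable ‖η‖ (hν.norm_eq.mono fun y hy => ?_)
    have h := norm_inner_le_norm (𝕜 := ℝ) η y
    rwa [hy, mul_one] at h
  have hi2 : Integrable (fun y => ⟪η, dMap η y⟫) ν := by
    have hc : Continuous fun y : Eu n => ⟪η, y⟫ := by fun_prop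
    refine Integrable.of_bound
      (hc.measurable.comp (measurable_dMap η)).aestronglyMeasurable ‖η‖
      (hν.norm_eq.mono fun y hy => ?_)
    have h := norm_inner_le_norm (𝕜 := ℝ) η (dMap η y)
    rwa [norm_dMap hη hy, mul_one] at h
  have hnn : 0 ≤ᵐ[ν] fun y => ⟪η, dMap η y⟫ - ⟪η, y⟫ := by
    refine hν.norm_eq.mono fun y hy => ?_
    refine nonneg_of_mul_nonneg_right (a := den η y) ?_ (den_pos hη hy)
    rw [hpos y hy]
    linarith [hcs y hy]
  have hae := (integral_eq_zero_iff_of_nonneg_ae hnn (hi2.sub hi1)).1 (by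
    rw [integral_sub hi2 hi1, h1, h2, sub_zero])
  by_contra hη0
  have hn0 : ‖η‖ ≠ 0 := norm_ne_zero_iff.2 hη0
  have hall : ∀ᵐ y ∂ν, y ∈ ({‖η‖⁻¹ • η} ∪ {-(‖η‖⁻¹ • η)} : Set (Eu n)) := by
    filter_upwards [hae, hν.norm_eq] with y hy hy1
    have h := hpos y hy1
    rw [show ⟪η, dMap η y⟫ - ⟪η, y⟫ = 0 from hy, mul_zero] at h
    have h3 : (⟪η, y⟫ - ‖η‖) * (⟪η, y⟫ + ‖η‖) = 0 := by linarith
    have key : ∀ ε : ℝ, ε ^ 2 = 1 → ⟪η, y⟫ = ε * ‖η‖ → y = ε • ‖η‖⁻¹ • η := by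
      intro ε hε he
      rw [← sub_eq_zero, ← norm_eq_zero, ← sq_eq_zero_iff, norm_sub_sq_real, hy1,
        real_inner_smul_right, real_inner_smul_right, real_inner_comm, he, norm_smul, norm_smul,
        norm_inv, norm_norm, norm_eq_abs, mul_pow, sq_abs, hε, inv_mul_cancel₀ hn0]
      field_simp
      linarith
    rcases mul_eq_zero.1 h3 with h4 | h4
    · exact Or.inl (by simpa using key 1 (by norm_num) (by linarith))
    · exact Or.inr (by simpa using key (-1) (by norm_num) (by linarith))
  have hnull : ν ({‖η‖⁻¹ • η} ∪ {-(‖η‖⁻¹ • η)} : Set (Eu n)) = 0 :=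
    measure_union_null (hν.singleton _) (hν.singleton _)
  refine hν0 (Measure.measure_univ_eq_zero.1 ?_)
  rw [← Set.union_compl_self ({‖η‖⁻¹ • η} ∪ {-(‖η‖⁻¹ • η)} : Set (Eu n))]
  exact measure_union_null hnull hall

lemma IsMaxDir.measure_ne_zero {n : ℕ} (hn : 1 ≤ n) {ν : Measure (Eu n)} {s₀ : Eu n}
    (h : IsMaxDir ν s₀) : ν ≠ 0 := by
  rintro rfl
  have hQ : ∀ s : Eu n, Qform (0 : Measure (Eu n)) s = 0 := fun s => by simp [Qform]
  have hmax : maxEig n (0 : Measure (Eu n)) = 0 := by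
    have : {q : ℝ | ∃ s : Eu n, ‖s‖ = 1 ∧ q = Qform (0 : Measure (Eu n)) s} = {0} := by
      ext q
      constructor
      · rintro ⟨s, -, rfl⟩
        exact hQ s
      · rintro rfl
        exact ⟨s₀, h.1, (hQ s₀).symm⟩
    rw [maxEig, this, csSup_singleton]
  obtain ⟨x, hx, hx0⟩ := exists_unit_orthogonal hn s₀
  obtain ⟨c, rfl⟩ := (h.2 x).1 (by rw [hQ, hmax, zero_mul])
  rw [real_inner_smul_right, real_inner_self_eq_norm_sq, h.1] at hx0
  rw [show c = 0 by linarith, zero_smul, norm_zero] at hx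
  exact zero_ne_one hx

lemma Qform_map_isometry {n : ℕ} (ν : Measure (Eu n)) (T : Eu n →ₗᵢ[ℝ] Eu n) (s : Eu n) :
    Qform (ν.map T) (T s) = Qform ν s := by
  have hc : Continuous fun y : Eu n => (⟪T s, y⟫ : ℝ) ^ 2 := by fun_prop
  rw [Qform, integral_map T.continuous.measurable.aemeasurable hc.aestronglyMeasurable, Qform]
  simp only [T.inner_map_map]

lemma IsMaxDir.map_isometry {n : ℕ} {ν : Measure (Eu n)} {s₀ : Eu n} (h : IsMaxDir ν s₀)
    (T : Eu n →ₗᵢ[ℝ] Eu n) : IsMaxDir (ν.map T) (T s₀) := by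
  have hsurj : Function.Surjective T := (T.toLinearIsometryEquiv rfl).surjective
  have hmax : maxEig n (ν.map T) = maxEig n ν := by
    rw [maxEig, maxEig]
    congr 1
    ext q
    constructor
    · rintro ⟨s, hs, rfl⟩
      obtain ⟨t, rfl⟩ := hsurj s
      exact ⟨t, by rwa [T.norm_map] at hs, Qform_map_isometry ν T t⟩
    · rintro ⟨t, ht, rfl⟩
      exact ⟨T t, by rwa [T.norm_map], (Qform_map_isometry ν T t).symm⟩
  refine ⟨by rw [T.norm_map, h.1], fun s => ?_⟩
  obtain ⟨t, rfl⟩ := hsurj s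
  rw [hmax, Qform_map_isometry, T.norm_map, h.2]
  refine exists_congr fun c => ?_
  rw [← map_smul, T.injective.eq_iff]

lemma IsMaxDir.eq_or_eq_neg {n : ℕ} {ν : Measure (Eu n)} {s t : Eu n} (hs : IsMaxDir ν s)
    (ht : IsMaxDir ν t) : s = t ∨ s = -t := by
  obtain ⟨c, hc⟩ := (ht.2 s).1 ((hs.2 s).2 ⟨1, (one_smul ℝ s).symm⟩)
  have h := hs.1
  rw [hc, norm_smul, ht.1, mul_one, norm_eq_abs] at h
  rcases eq_or_eq_neg_of_abs_eq h with h | h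
  · exact Or.inl (by rw [hc, h, one_smul])
  · exact Or.inr (by rw [hc, h, neg_one_smul])

/-! ### Symmetric caps -/

/-- The map `R_a = d_{ξ'} ∘ τ_a ∘ d_{-ξ}`, where `ξ` and `ξ'` are the renormalization points of a
cap `a` and of its complement. -/
def capMap {n : ℕ} (ξ ξ' : Eu n) (r : ℝ) (p : Eu n) : Eu n → Eu n :=
  dMap ξ' ∘ tauMap r p ∘ dMap (-ξ)

lemma capMap_dMap {n : ℕ} {ξ x : Eu n} (ξ' : Eu n) (r : ℝ) (p : Eu n) (hξ : ‖ξ‖ < 1)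
    (hx : ‖x‖ = 1) : capMap ξ ξ' r p (dMap ξ x) = dMap ξ' (tauMap r p x) := by
  rw [capMap, Function.comp_apply, Function.comp_apply, dMap_neg_dMap hξ hx]

lemma exists_isMob_capMap {n : ℕ} {ξ ξ' : Eu n} {r : ℝ} {p : Eu n} (hξ : ‖ξ‖ < 1)
    (hξ' : ‖ξ'‖ < 1) (hr : r ∈ Set.Ioo (-1 : ℝ) 1) (hp : ‖p‖ = 1) :
    ∃ A b M c, IsMob (capMap ξ ξ' r p) A b M c := by
  have h := norm_smul_lt_one hr hp
  exact ⟨_, _, _, _, (isMob_dMap hξ').comp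
    (((isMob_dMap h).comp ((isMob_Refl hp).comp (isMob_dMap (by rwa [norm_neg])))).comp
      (isMob_dMap (by rwa [norm_neg])))⟩

lemma capMap_injOn {n : ℕ} {ξ ξ' : Eu n} {r : ℝ} {p : Eu n} (hξ : ‖ξ‖ < 1)
    (hξ' : ‖ξ'‖ < 1) (hr : r ∈ Set.Ioo (-1 : ℝ) 1) (hp : ‖p‖ = 1) (x y : Eu n) (hx : ‖x‖ = 1)
    (hy : ‖y‖ = 1) (h : capMap ξ ξ' r p x = capMap ξ ξ' r p y) : x = y := by
  have hξn : ‖-ξ‖ < 1 := by rwa [norm_neg]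
  have hx1 := norm_dMap hξn hx
  have hy1 := norm_dMap hξn hy
  have h1 : tauMap r p (dMap (-ξ) x) = tauMap r p (dMap (-ξ) y) := by
    rw [← dMap_neg_dMap hξ' (norm_tauMap hr hp hx1), ← dMap_neg_dMap hξ' (norm_tauMap hr hp hy1)]
    exact congrArg _ h
  have h2 : dMap (-ξ) x = dMap (-ξ) y := by
    rw [← tauMap_tauMap hr hp hx1, h1, tauMap_tauMap hr hp hy1]
  rw [← dMap_dMap_neg hξ hx, h2, dMap_dMap_neg hξ hy]

lemma measurable_capMap {n : ℕ} (ξ ξ' : Eu n) (r : ℝ) (p : Eu n) :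
    Measurable (capMap ξ ξ' r p) :=
  (measurable_dMap _).comp ((measurable_tauMap r p).comp (measurable_dMap _))

/-- The renormalized measures of symmetric caps are exchanged by `R_a`. -/
lemma map_capMeasure_neg_neg {n : ℕ} {w : Eu n → ℝ} (hw : IsSph (confMeasure n w)) {r : ℝ}
    {p ξ : Eu n} (ξ' : Eu n) (hr : r ∈ Set.Ioo (-1 : ℝ) 1) (hp : ‖p‖ = 1) (hξ : ‖ξ‖ < 1) :
    (capMeasure n w (-r) (-p)).map (dMap ξ') =
      ((capMeasure n w r p).map (dMap ξ)).map (capMap ξ ξ' r p) := by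
  rw [capMeasure_neg_neg hw hr hp, Measure.map_map (measurable_dMap _) (measurable_tauMap r p),
    Measure.map_map (measurable_capMap _ _ _ _) (measurable_dMap _)]
  exact Measure.map_congr ((isSph_capMeasure hw hr hp).norm_eq.mono fun x hx =>
    (capMap_dMap ξ' r p hξ hx).symm)

lemma integral_inner_eq_zero_of_renormalizes {n : ℕ} {ξ : Eu n} {μ : Measure (Eu n)}
    (h : Renormalizes ξ μ) (s : Eu n) : ∫ y, ⟪s, y⟫ ∂(μ.map (dMap ξ)) = 0 := by
  have hc : Continuous fun y : Eu n => ⟪s, y⟫ := by fun_prop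
  rw [integral_map (measurable_dMap ξ).aemeasurable hc.aestronglyMeasurable]
  by_cases hs : s = 0
  · simp [hs]
  have h1 := h (‖s‖⁻¹ • s) (mem_sphSet.2 (norm_smul_inv_norm hs))
  simp only [Xfun, real_inner_smul_left, integral_const_mul] at h1
  exact (mul_eq_zero.1 h1).resolve_left (inv_ne_zero (norm_ne_zero_iff.2 hs))

/-- The map `R_a` of a cap is a linear isometry of the sphere. -/
lemma exists_isometry_capMap {n : ℕ} {w : Eu n → ℝ} (hw : IsSph (confMeasure n w)) {r : ℝ}
    {p ξ ξ' : Eu n} (hr : r ∈ Set.Ioo (-1 : ℝ) 1) (hp : ‖p‖ = 1) (hξ : ‖ξ‖ < 1)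
    (hξ' : ‖ξ'‖ < 1) (hren : Renormalizes ξ (capMeasure n w r p))
    (hren' : Renormalizes ξ' (capMeasure n w (-r) (-p)))
    (hne : (capMeasure n w r p).map (dMap ξ) ≠ 0) :
    ∃ T : Eu n →ₗᵢ[ℝ] Eu n, ∀ x : Eu n, ‖x‖ = 1 → capMap ξ ξ' r p x = T x := by
  obtain ⟨A, b, M, c, hmob⟩ := exists_isMob_capMap hξ hξ' hr hp
  obtain ⟨η, hη, T, hT⟩ := hmob.exists_decomp (capMap_injOn hξ hξ' hr hp)
  have hν : IsSph ((capMeasure n w r p).map (dMap ξ)) :=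
    (isSph_capMeasure hw hr hp).map (measurable_dMap ξ) (fun x => norm_dMap hξ)
      fun x y hx hy h => by rw [← dMap_neg_dMap hξ hx, h, dMap_neg_dMap hξ hy]
  have h2 : ∫ y, ⟪η, dMap η y⟫ ∂((capMeasure n w r p).map (dMap ξ)) = 0 := by
    have h := integral_inner_eq_zero_of_renormalizes hren' (T η)
    have hc : Continuous fun y : Eu n => ⟪T η, y⟫ := by fun_prop
    rw [map_capMeasure_neg_neg hw ξ' hr hp hξ,
      integral_map (measurable_capMap _ _ _ _).aemeasurable hc.aestronglyMeasurable] at h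
    rw [← h]
    refine integral_congr_ae (hν.norm_eq.mono fun y hy => ?_)
    simp only [hT y hy, T.inner_map_map]
  have h0 := eq_zero_of_centered hν hne hη (integral_inner_eq_zero_of_renormalizes hren η) h2
  refine ⟨T, fun x hx => ?_⟩
  rw [hT x hx, h0, dMap_zero]

/-- If `R_a` is linear for a half-sphere `a`, it is the reflection of `a`. -/
lemma capMap_zero_eq_Refl {n : ℕ} (hn : 1 ≤ n) {p ξ ξ' : Eu n} (hp : ‖p‖ = 1) (hξ : ‖ξ‖ < 1)
    (hξ' : ‖ξ'‖ < 1) (T : Eu n →ₗᵢ[ℝ] Eu n)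
    (hT : ∀ x : Eu n, ‖x‖ = 1 → capMap ξ ξ' 0 p x = T x) {x : Eu n} (hx : ‖x‖ = 1) :
    capMap ξ ξ' 0 p x = Refl p x := by
  have hζ : ‖Refl p ξ‖ < 1 := by rwa [norm_Refl hp]
  have hneg : ∀ y : Eu n, Refl p (-y) = -Refl p y := by
    intro y
    simp only [Refl, inner_neg_right]
    module
  have hτ : ∀ y : Eu n, capMap ξ ξ' 0 p y = dMap ξ' (dMap (-Refl p ξ) (Refl p y)) := by
    intro y
    simp only [capMap, tauMap, Function.comp_apply, zero_smul, neg_zero, dMap_zero]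
    rw [Refl_dMap hp, hneg]
  have heq : ξ' = Refl p ξ := by
    refine eq_of_dMap_odd hn hξ' hζ fun y hy => ?_
    have hy1 : ‖Refl p y‖ = 1 := by rw [norm_Refl hp, hy]
    have h1 := hτ (Refl p y)
    have h2 := hτ (-Refl p y)
    rw [Refl_Refl hp] at h1
    rw [hneg, Refl_Refl hp] at h2
    rw [← h1, ← h2, hT _ hy1, hT _ (by rwa [norm_neg]), map_neg]
  rw [hτ, heq, dMap_dMap_neg hζ (by rw [norm_Refl hp, hx])]

/-- The relation between test functions of symmetric caps, when the maximal directions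
are exchanged by `-R_a`. -/
lemma testFun_neg_neg {n : ℕ} {r : ℝ} {p ξ ξ' s s' : Eu n} (hr : r ∈ Set.Ioo (-1 : ℝ) 1)
    (hp : ‖p‖ = 1) (hξ : ‖ξ‖ < 1) (T : Eu n →ₗᵢ[ℝ] Eu n)
    (hT : ∀ x : Eu n, ‖x‖ = 1 → capMap ξ ξ' r p x = T x) (hs : s' = -T s) {x : Eu n}
    (hx : ‖x‖ = 1) :
    testFun n ξ' (-r) (-p) s' x = -testFun n ξ r p s x := by
  have h1 : ∀ y : Eu n, ‖y‖ = 1 → Xfun s' (dMap ξ' (tauMap r p y)) = -Xfun s (dMap ξ y) := by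
    intro y hy
    rw [← capMap_dMap ξ' r p hξ hy, hT _ (norm_dMap hξ hy), hs, Xfun, Xfun, inner_neg_left,
      T.inner_map_map]
  have h2 : Xfun s' (dMap ξ' x) = -Xfun s (dMap ξ (tauMap r p x)) := by
    rw [← h1 _ (norm_tauMap hr hp hx), tauMap_tauMap hr hp hx]
  rw [testFun, testFun, tauMap_neg_neg, neg_smul_neg, inner_neg_left, h1 x hx, h2]
  rcases lt_trichotomy 0 ⟪p, dMap (-(r • p)) x⟫ with h | h | h
  · rw [if_neg (by linarith), if_pos h]
  · rw [if_neg (by linarith), if_neg (by linarith)]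
    have : tauMap r p x = x := by
      have h3 : Refl p (dMap (-(r • p)) x) = dMap (-(r • p)) x := by
        rw [Refl, ← h, mul_zero, zero_smul, sub_zero]
      rw [tauMap, Function.comp_apply, Function.comp_apply, h3,
        dMap_dMap_neg (norm_smul_lt_one hr hp) hx]
    rw [this]
  · rw [if_pos (by linarith), if_neg (by linarith)]

lemma continuousOn_tauMap {n : ℕ} {X : Type*} [TopologicalSpace X] {S : Set X} {r : X → ℝ}
    {p f : X → Eu n} (hr : ContinuousOn r S) (hp : ContinuousOn p S) (hf : ContinuousOn f S)
    (hr1 : ∀ q ∈ S, r q ∈ Set.Ioo (-1 : ℝ) 1) (hp1 : ∀ q ∈ S, ‖p q‖ = 1)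
    (hf1 : ∀ q ∈ S, ‖f q‖ = 1) : ContinuousOn (fun q => tauMap (r q) (p q) (f q)) S := by
  have hrp : ContinuousOn (fun q => r q • p q) S := hr.smul hp
  have b0 : ∀ q ∈ S, ‖r q • p q‖ < 1 := fun q hq => norm_smul_lt_one (hr1 q hq) (hp1 q hq)
  have b1 : ∀ q ∈ S, ‖-(r q • p q)‖ < 1 := fun q hq => by rw [norm_neg]; exact b0 q hq
  have c1 : ContinuousOn (fun q => dMap (-(r q • p q)) (f q)) S :=
    continuousOn_dMap hrp.neg hf b1 hf1
  have c2 : ContinuousOn (fun q => Refl (p q) (dMap (-(r q • p q)) (f q))) S :=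
    continuous_Refl.comp_continuousOn (hp.prodMk c1)
  exact continuousOn_dMap hrp c2 b0 fun q hq => by
    rw [Function.comp_apply, norm_Refl (hp1 q hq), norm_dMap (b1 q hq) (hf1 q hq)]

lemma continuousOn_capMap {n : ℕ} {X : Type*} [TopologicalSpace X] {S : Set X} {r : X → ℝ}
    {ξ ξ' p f : X → Eu n} (hξ : ContinuousOn ξ S) (hξ' : ContinuousOn ξ' S)
    (hr : ContinuousOn r S) (hp : ContinuousOn p S) (hf : ContinuousOn f S)
    (hξ1 : ∀ q ∈ S, ‖ξ q‖ < 1) (hξ1' : ∀ q ∈ S, ‖ξ' q‖ < 1)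
    (hr1 : ∀ q ∈ S, r q ∈ Set.Ioo (-1 : ℝ) 1) (hp1 : ∀ q ∈ S, ‖p q‖ = 1)
    (hf1 : ∀ q ∈ S, ‖f q‖ = 1) :
    ContinuousOn (fun q => capMap (ξ q) (ξ' q) (r q) (p q) (f q)) S := by
  have b1 : ∀ q ∈ S, ‖-ξ q‖ < 1 := fun q hq => by rw [norm_neg]; exact hξ1 q hq
  have b2 : ∀ q ∈ S, ‖dMap (-ξ q) (f q)‖ = 1 := fun q hq => norm_dMap (b1 q hq) (hf1 q hq)
  have c1 : ContinuousOn (fun q => dMap (-ξ q) (f q)) S := continuousOn_dMap hξ.neg hf b1 hf1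
  exact continuousOn_dMap hξ' (continuousOn_tauMap hr hp c1 hr1 hp1 b2) hξ1'
    fun q hq => norm_tauMap (hr1 q hq) (hp1 q hq) (b2 q hq)

/-- The maximal directions of symmetric caps correspond, up to sign, under `R_a`. -/
lemma exists_isometry_maxDir {n : ℕ} (hn : 1 ≤ n) {w : Eu n → ℝ} (hw : IsSph (confMeasure n w))
    {r : ℝ} {p ξ ξ' s s' : Eu n} (hr : r ∈ Set.Ioo (-1 : ℝ) 1) (hp : ‖p‖ = 1) (hξ : ‖ξ‖ < 1)
    (hξ' : ‖ξ'‖ < 1) (hren : Renormalizes ξ (capMeasure n w r p))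
    (hren' : Renormalizes ξ' (capMeasure n w (-r) (-p)))
    (hs : IsMaxDir ((capMeasure n w r p).map (dMap ξ)) s)
    (hs' : IsMaxDir ((capMeasure n w (-r) (-p)).map (dMap ξ')) s') :
    ∃ T : Eu n →ₗᵢ[ℝ] Eu n, (∀ x : Eu n, ‖x‖ = 1 → capMap ξ ξ' r p x = T x) ∧
      (s' = T s ∨ s' = -T s) := by
  obtain ⟨T, hT⟩ := exists_isometry_capMap hw hr hp hξ hξ' hren hren' (hs.measure_ne_zero hn)
  refine ⟨T, hT, ?_⟩
  have hν : IsSph ((capMeasure n w r p).map (dMap ξ)) :=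
    (isSph_capMeasure hw hr hp).map (measurable_dMap ξ) (fun x => norm_dMap hξ)
      fun x y hx hy h => by rw [← dMap_neg_dMap hξ hx, h, dMap_neg_dMap hξ hy]
  rw [map_capMeasure_neg_neg hw ξ' hr hp hξ, Measure.map_congr (hν.norm_eq.mono hT)] at hs'
  exact hs'.eq_or_eq_neg (hs.map_isometry T)

/-- Assume all the measures `dv_g` and `ν_a` are simple and let `s` be the
continuous lift of the maximal directions with `s(-1,·) = -e₁`; set `u_a = u_a^{s(a)}`.
Then `u_{a*} = -u_a` on `S^n` for every cap `a`. -/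
theorem testFun_of_symmetric_cap (n : ℕ) (hn : 2 ≤ n)
    (w : Eu n → ℝ) (hw : IsConformalFactor n w) (hvol : confMeasure n w Set.univ = 1)
    (hmean : ∀ t : Eu n, ∫ x, (⟪t, x⟫ : ℝ) ∂(confMeasure n w) = 0)
    (hsimple : IsMaxDir (confMeasure n w) (e1 n))
    (ξfun : ℝ → Eu n → Eu n) (sfun : ℝ → Eu n → Eu n)
    (hξ : ∀ r ∈ Set.Ioo (-1 : ℝ) 1, ∀ p ∈ sphSet n,
      ‖ξfun r p‖ < 1 ∧ Renormalizes (ξfun r p) (capMeasure n w r p))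
    (hξcont : ContinuousOn (fun q : ℝ × Eu n => ξfun q.1 q.2)
      (Set.Ioo (-1 : ℝ) 1 ×ˢ sphSet n))
    (hmax : ∀ r ∈ Set.Ioo (-1 : ℝ) 1, ∀ p ∈ sphSet n,
      IsMaxDir (Measure.map (dMap (ξfun r p)) (capMeasure n w r p)) (sfun r p))
    (hscont : ContinuousOn (fun q : ℝ × Eu n => sfun q.1 q.2)
      (Set.Ico (-1 : ℝ) 1 ×ˢ sphSet n))
    (hinit : ∀ p ∈ sphSet n, sfun (-1) p = -(e1 n)) :
    ∀ r ∈ Set.Ioo (-1 : ℝ) 1, ∀ p ∈ sphSet n, ∀ x ∈ sphSet n,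
      testFun n (ξfun (-r) (-p)) (-r) (-p) (sfun (-r) (-p)) x =
        -(testFun n (ξfun r p) r p (sfun r p) x) := by
  have hn1 : 1 ≤ n := by omega
  have hconf := isSph_confMeasure hn1 hvol
  have hneg : ∀ r ∈ Set.Ioo (-1 : ℝ) 1, -r ∈ Set.Ioo (-1 : ℝ) 1 :=
    fun r hr => ⟨by linarith [hr.2], by linarith [hr.1]⟩
  have hnegS : ∀ p ∈ sphSet n, -p ∈ sphSet n :=
    fun p hp => mem_sphSet.2 (by rw [norm_neg]; exact mem_sphSet.1 hp)
  have hdir : ∀ r ∈ Set.Ioo (-1 : ℝ) 1, ∀ p ∈ sphSet n, ∃ T : Eu n →ₗᵢ[ℝ] Eu n,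
      (∀ x : Eu n, ‖x‖ = 1 → capMap (ξfun r p) (ξfun (-r) (-p)) r p x = T x) ∧
      (sfun (-r) (-p) = T (sfun r p) ∨ sfun (-r) (-p) = -T (sfun r p)) := by
    intro r hr p hp
    obtain ⟨hξ1, hren⟩ := hξ r hr p hp
    obtain ⟨hξ1', hren'⟩ := hξ (-r) (hneg r hr) (-p) (hnegS p hp)
    exact exists_isometry_maxDir hn1 hconf hr (mem_sphSet.1 hp) hξ1 hξ1' hren hren'
      (hmax r hr p hp) (hmax (-r) (hneg r hr) (-p) (hnegS p hp))
  obtain ⟨ε, hε⟩ : ∃ ε : ℝ × Eu n → ℝ, ∀ q, ε q = ⟪sfun (-q.1) (-q.2),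
      capMap (ξfun q.1 q.2) (ξfun (-q.1) (-q.2)) q.1 q.2 (sfun q.1 q.2)⟫ :=
    ⟨_, fun _ => rfl⟩
  have hcont : ContinuousOn ε (Set.Ioo (-1 : ℝ) 1 ×ˢ sphSet n) := by
    rw [funext hε]
    have hmaps : Set.MapsTo (fun q : ℝ × Eu n => (-q.1, -q.2))
        (Set.Ioo (-1 : ℝ) 1 ×ˢ sphSet n) (Set.Ioo (-1 : ℝ) 1 ×ˢ sphSet n) :=
      fun q hq => ⟨hneg q.1 hq.1, hnegS q.2 hq.2⟩
    have hc : Continuous fun q : ℝ × Eu n => (-q.1, -q.2) := by fun_prop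
    have hs : ContinuousOn (fun q : ℝ × Eu n => sfun q.1 q.2)
        (Set.Ioo (-1 : ℝ) 1 ×ˢ sphSet n) :=
      hscont.mono (Set.prod_mono_left Set.Ioo_subset_Ico_self)
    have hs' : ContinuousOn (fun q : ℝ × Eu n => sfun (-q.1) (-q.2))
        (Set.Ioo (-1 : ℝ) 1 ×ˢ sphSet n) := hs.comp hc.continuousOn hmaps
    have hξ' : ContinuousOn (fun q : ℝ × Eu n => ξfun (-q.1) (-q.2))
        (Set.Ioo (-1 : ℝ) 1 ×ˢ sphSet n) := hξcont.comp hc.continuousOn hmaps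
    exact hs'.inner (continuousOn_capMap hξcont hξ' continuousOn_fst continuousOn_snd hs
      (fun q hq => (hξ q.1 hq.1 q.2 hq.2).1)
      (fun q hq => (hξ _ (hmaps hq).1 _ (hmaps hq).2).1) (fun q hq => hq.1)
      (fun q hq => mem_sphSet.1 hq.2) fun q hq => (hmax q.1 hq.1 q.2 hq.2).1)
  have hconn : IsPreconnected (Set.Ioo (-1 : ℝ) 1 ×ˢ sphSet n) := by
    refine isPreconnected_Ioo.prod (isPreconnected_sphere ?_ _ _)
    rw [← Module.finrank_eq_rank, finrank_euclideanSpace_fin]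
    exact_mod_cast (by omega : 1 < n + 1)
  have hnot := not_reflection_equivariant sfun (-(e1 n)) (by simp [e1])
    (hscont.mono (Set.prod_mono_left fun r hr => ⟨hr.1, by linarith [hr.2]⟩))
    (fun r hr p hp => by
      rcases hr.1.eq_or_lt with h | h
      · rw [← h, hinit p hp]
        simp [e1]
      · exact (hmax r ⟨h, by linarith [hr.2]⟩ p hp).1) hinit
  push Not at hnot
  obtain ⟨p₀, hp₀, hne⟩ := hnot
  have h0 : (0 : ℝ) ∈ Set.Ioo (-1 : ℝ) 1 := by norm_num
  have hinner : ∀ r ∈ Set.Ioo (-1 : ℝ) 1, ∀ p ∈ sphSet n, ∀ T : Eu n →ₗᵢ[ℝ] Eu n,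
      ⟪T (sfun r p), T (sfun r p)⟫ = (1 : ℝ) := by
    intro r hr p hp T
    rw [T.inner_map_map, real_inner_self_eq_norm_sq, (hmax r hr p hp).1, one_pow]
  have hp₀neg : ε (0, p₀) < 0 := by
    rw [hε]
    dsimp only
    obtain ⟨T, hT, hs⟩ := hdir 0 h0 p₀ hp₀
    have hs1 := (hmax 0 h0 p₀ hp₀).1
    rcases hs with hs | hs
    · refine absurd ?_ hne
      rw [← neg_zero, hs, neg_zero, ← hT _ hs1]
      exact capMap_zero_eq_Refl hn1 (mem_sphSet.1 hp₀) (hξ 0 h0 p₀ hp₀).1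
        (hξ (-0) (hneg 0 h0) (-p₀) (hnegS p₀ hp₀)).1 T hT hs1
    · rw [hs, hT _ hs1, inner_neg_left, hinner 0 h0 p₀ hp₀]
      norm_num
  intro r hr p hp x hx
  obtain ⟨T, hT, hs⟩ := hdir r hr p hp
  refine testFun_neg_neg hr (mem_sphSet.1 hp) (hξ r hr p hp).1 T hT (hs.resolve_left ?_)
    (mem_sphSet.1 hx)
  intro hs
  have hpos : 0 < ε (r, p) := by
    rw [hε]
    dsimp only
    rw [hs, hT _ (hmax r hr p hp).1, hinner r hr p hp]
    norm_num
  obtain ⟨q, hq, hq0⟩ := hconn.intermediate_value (Set.mk_mem_prod h0 hp₀)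
    (Set.mk_mem_prod hr hp) hcont ⟨hp₀neg.le, hpos.le⟩
  obtain ⟨T', hT', hs'⟩ := hdir q.1 hq.1 q.2 hq.2
  have h1 := hinner q.1 hq.1 q.2 hq.2 T'
  rw [hε, hT' _ (hmax q.1 hq.1 q.2 hq.2).1] at hq0
  rcases hs' with hs' | hs'
  · rw [hs', h1] at hq0
    exact one_ne_zero hq0
  · rw [hs', inner_neg_left, h1] at hq0
    norm_num at hq0

end
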